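/- Let N_CB(x) be the number of ternary integers n = pqr ≤ x (with 3 ≤ p < q < r odd primes) such that h(Φ_n) ≤ 2p/3, where p is the smallest prime factor of n. Then N_CB(x) ≥ (25/27 + o(1))·(x·(log log x)²)/(2·log x) as x → ∞. -/

import Mathlib

open Real Filter Polynomial

/-- The height of a polynomial over `ℤ`: the maximum of the absolute values of
its coefficients. -/
noncomputable def polyHeight (f : Polynomial ℤ) : ℕ :=
  f.support.sup fun k => (f.coeff k).natAbs

/-- `N_CB(x)`: the number of ternary `n = pqr ≤ x` (with `3 ≤ p < q < r` odd primes)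
with `h(Φ_n) ≤ 2p/3`, where `p` is the smallest prime factor of `n`. -/
noncomputable def NCBcount (x : ℝ) : ℕ :=
  {n : ℕ | ∃ p q r : ℕ, p.Prime ∧ q.Prime ∧ r.Prime ∧
    3 ≤ p ∧ p < q ∧ q < r ∧ n = p * q * r ∧ (n : ℝ) ≤ x ∧
    (polyHeight (Polynomial.cyclotomic n ℤ) : ℝ) ≤ 2 * (p : ℝ) / 3}.ncard

namespace CB
open MeasureTheory Topology

/-- The triangle function. -/
noncomputable def tri (t : ℝ) : ℝ := max 0 (1 - |t|)

lemma tri_cont : Continuous tri := by unfold tri; fun_prop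

lemma tri_nonneg (t : ℝ) : 0 ≤ tri t := le_max_left _ _

lemma tri_zero_of {t : ℝ} (h : 1 ≤ |t|) : tri t = 0 := by
  unfold tri; exact max_eq_left (by linarith)

lemma tri_supp : HasCompactSupport tri := by
  apply HasCompactSupport.intro (isCompact_Icc (a := (-1:ℝ)) (b := 1))
  intro t ht
  apply tri_zero_of
  by_contra h
  push Not at h
  exact ht ⟨(abs_lt.mp h).1.le, (abs_lt.mp h).2.le⟩

/-- The Fejer kernel. -/
noncomputable def Kf (w : ℝ) : ℝ := ∫ t, tri t * cos (t * w)

lemma tri_int : Integrable tri := tri_cont.integrable_of_hasCompactSupport tri_supp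

lemma tri_mul_int {f : ℝ → ℝ} (hf : Continuous f) : Integrable (fun t => tri t * f t) :=
  (tri_cont.mul hf).integrable_of_hasCompactSupport tri_supp.mul_right

lemma Kf_eq {w : ℝ} (hw : w ≠ 0) : Kf w = 2 * (1 - cos w) / w ^ 2 := by
  have h1 : Kf w = ∫ t in (-1:ℝ)..1, tri t * cos (t * w) := by
    rw [Kf, intervalIntegral.integral_of_le (by norm_num), ← integral_Icc_eq_integral_Ioc,
      setIntegral_eq_integral_of_forall_compl_eq_zero]
    intro t ht
    rw [tri_zero_of, zero_mul]
    by_contra h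
    push Not at h
    exact ht ⟨(abs_lt.mp h).1.le, (abs_lt.mp h).2.le⟩
  have hc : Continuous fun t => tri t * cos (t * w) := tri_cont.mul (by fun_prop)
  have h2 : ∫ t in (0:ℝ)..1, tri t * cos (t * w) = (1 - cos w) / w ^ 2 := by
    have : ∫ t in (0:ℝ)..1, tri t * cos (t * w) = ∫ t in (0:ℝ)..1, (1 - t) * cos (t * w) := by
      apply intervalIntegral.integral_congr
      intro t ht
      rw [Set.uIcc_of_le (by norm_num)] at ht
      simp only [tri]
      rw [abs_of_nonneg ht.1, max_eq_right (by linarith [ht.2])]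
    rw [this, intervalIntegral.integral_eq_sub_of_hasDerivAt
      (f := fun t => (1 - t) * sin (t * w) / w - cos (t * w) / w ^ 2)]
    · simp; field_simp; ring
    · intro t _
      have hs : HasDerivAt (fun t => sin (t * w)) (cos (t * w) * w) t := by
        simpa using (hasDerivAt_mul_const w (x := t)).sin
      have hcc : HasDerivAt (fun t => cos (t * w)) (-sin (t * w) * w) t := by
        simpa using (hasDerivAt_mul_const w (x := t)).cos
      have h1t : HasDerivAt (fun t : ℝ => 1 - t) (-1) t := by
        simpa using (hasDerivAt_id t).const_sub 1
      have h5 := ((h1t.mul hs).div_const w).sub (hcc.div_const (w ^ 2))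
      have h6 : (-1 * sin (t * w) + (1 - t) * (cos (t * w) * w)) / w - -sin (t * w) * w / w ^ 2
          = (1 - t) * cos (t * w) := by
        field_simp
        ring
      rw [h6] at h5
      exact h5
    · exact (by fun_prop : Continuous fun t => (1 - t) * cos (t * w)).intervalIntegrable _ _
  have h3 : ∫ t in (-1:ℝ)..0, tri t * cos (t * w) = (1 - cos w) / w ^ 2 := by
    rw [← h2]
    have := intervalIntegral.integral_comp_neg (a := 0) (b := 1) (fun t => tri t * cos (t * w))
    rw [neg_zero] at this
    rw [← this]
    apply intervalIntegral.integral_congr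
    intro t _
    simp [tri]
  rw [h1, ← intervalIntegral.integral_add_adjacent_intervals (b := 0) (hc.intervalIntegrable _ _)
    (hc.intervalIntegrable _ _), h2, h3]
  ring

lemma Kf_nonneg (w : ℝ) : 0 ≤ Kf w := by
  rcases eq_or_ne w 0 with rfl | hw
  · unfold Kf; apply integral_nonneg; intro t; simp [tri_nonneg]
  · rw [Kf_eq hw]; exact div_nonneg (by linarith [cos_le_one w]) (sq_nonneg _)

lemma Kf_le_inv {w : ℝ} (hw : w ≠ 0) : Kf w ≤ 4 / w ^ 2 := by
  rw [Kf_eq hw]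
  have := neg_one_le_cos w
  gcongr
  linarith

lemma Kf_le_const (w : ℝ) : Kf w ≤ ∫ t, tri t := by
  unfold Kf
  apply integral_mono (tri_mul_int (by fun_prop)) tri_int
  intro t
  exact mul_le_of_le_one_right (tri_nonneg t) (cos_le_one _)

lemma Kf_int : Integrable Kf := by
  have hm : AEStronglyMeasurable Kf volume := by
    have : Kf =ᵐ[volume] fun w => 2 * (1 - cos w) / w ^ 2 := by
      filter_upwards [compl_mem_ae_iff.mpr (measure_singleton (0:ℝ))] with w hw
      exact Kf_eq hw
    apply AEStronglyMeasurable.congr _ this.symm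
    apply Measurable.aestronglyMeasurable
    fun_prop
  set B := ∫ t, tri t
  have hB : 0 ≤ B := integral_nonneg tri_nonneg
  refine Integrable.mono' (integrable_inv_one_add_sq.const_mul (B + 4)) hm ?_
  refine Eventually.of_forall fun w => ?_
  rw [Real.norm_of_nonneg (Kf_nonneg w), ← div_eq_mul_inv, le_div_iff₀ (by positivity)]
  rcases eq_or_ne w 0 with rfl | hw
  · nlinarith [Kf_le_const 0]
  · have h1 := Kf_le_inv hw
    rw [le_div_iff₀ (by positivity)] at h1
    nlinarith [Kf_le_const w]

lemma Kf_integral_pos : 0 < ∫ w, Kf w := by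
  have h1 : ∫ w in Set.Icc (1:ℝ) 2, (1 - cos 1) / 2 ≤ ∫ w in Set.Icc (1:ℝ) 2, Kf w := by
    apply setIntegral_mono_on (by simp) Kf_int.integrableOn measurableSet_Icc
    intro w hw
    rw [Kf_eq (by linarith [hw.1])]
    have h2 : cos w ≤ cos 1 := cos_le_cos_of_nonneg_of_le_pi (by norm_num)
      (by linarith [hw.2, pi_gt_three]) hw.1
    have h3 : w ^ 2 ≤ 4 := by nlinarith [hw.1, hw.2]
    have h4 : 0 < w ^ 2 := by nlinarith [hw.1]
    rw [div_le_div_iff₀ (by norm_num) h4]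
    nlinarith [cos_le_one w]
  have h2 : ∫ w in Set.Icc (1:ℝ) 2, Kf w ≤ ∫ w, Kf w :=
    setIntegral_le_integral Kf_int (Eventually.of_forall Kf_nonneg)
  have h3 : cos 1 < 1 := by
    have := cos_lt_cos_of_nonneg_of_le_pi (x := 0) (y := 1) le_rfl (by linarith [pi_gt_three])
      (by norm_num)
    simpa using this
  simp at h1
  linarith

lemma Kf_complex (w : ℝ) : ∫ t : ℝ, (tri t : ℂ) * Complex.exp (Complex.I * t * w) = Kf w := by
  have h0 : ∀ t : ℝ, (tri t : ℂ) * Complex.exp (Complex.I * t * w)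
      = ((tri t * cos (t * w) : ℝ) : ℂ) + ((tri t * sin (t * w) : ℝ) : ℂ) * Complex.I := by
    intro t
    rw [show Complex.I * t * w = ((t * w : ℝ) : ℂ) * Complex.I by push_cast; ring,
      Complex.exp_mul_I]
    push_cast; ring
  have hs : ∫ t : ℝ, tri t * sin (t * w) = 0 := by
    have := integral_neg_eq_self (fun t : ℝ => tri t * sin (t * w)) volume
    simp only [neg_mul, sin_neg, tri, abs_neg, mul_neg, integral_neg] at this
    simp only [tri]
    linarith
  simp_rw [h0]
  rw [integral_add, integral_mul_const, integral_complex_ofReal, integral_complex_ofReal, hs]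
  · simp [Kf]
  · exact (tri_mul_int (by fun_prop)).ofReal
  · exact ((tri_mul_int (by fun_prop)).ofReal (𝕜 := ℂ)).mul_const _

end CB

namespace CB
open MeasureTheory Topology

lemma Kf_complex_scale {lam : ℝ} (hl : 0 < lam) (w : ℝ) :
    ∫ t : ℝ, (tri (t / lam) : ℂ) * Complex.exp (Complex.I * t * w)
      = ((lam * Kf (lam * w) : ℝ) : ℂ) := by
  have h := Measure.integral_comp_div
    (fun s : ℝ => (tri s : ℂ) * Complex.exp (Complex.I * s * ((lam * w : ℝ) : ℂ))) lam
  rw [Kf_complex, abs_of_pos hl] at h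
  have h2 : ∀ t : ℝ, (tri (t / lam) : ℂ) * Complex.exp (Complex.I * t * w)
      = (tri (t / lam) : ℂ) * Complex.exp (Complex.I * ((t / lam : ℝ) : ℂ) * ((lam * w : ℝ) : ℂ)) := by
    intro t
    congr 2
    have : (lam : ℂ) ≠ 0 := by exact_mod_cast hl.ne'
    push_cast
    field_simp
  simp_rw [h2, h]
  simp

lemma tri_scale_cont (lam : ℝ) : Continuous fun t => tri (t / lam) :=
  tri_cont.comp (by fun_prop)

lemma tri_scale_zero {lam : ℝ} (hl : 0 < lam) {t : ℝ} (ht : t ∉ Set.Icc (-lam) lam) :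
    tri (t / lam) = 0 := by
  apply tri_zero_of
  by_contra h
  push Not at h
  rw [abs_div, abs_of_pos hl, div_lt_one hl] at h
  exact ht ⟨(abs_lt.mp h).1.le, (abs_lt.mp h).2.le⟩

lemma tri_scale_supp {lam : ℝ} (hl : 0 < lam) : HasCompactSupport fun t => tri (t / lam) :=
  HasCompactSupport.intro (isCompact_Icc (a := -lam) (b := lam)) fun _ ht => tri_scale_zero hl ht

lemma tri_scale_int {lam : ℝ} (hl : 0 < lam) : Integrable fun t => tri (t / lam) :=
  (tri_scale_cont lam).integrable_of_hasCompactSupport (tri_scale_supp hl)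

lemma taub_fubini {b : ℝ → ℝ} (hbm : Measurable b) {C : ℝ} (hb : ∀ u, |b u| ≤ C)
    {G : ℂ → ℂ} (hGb : ∀ z : ℂ, 0 < z.re →
      G z = ∫ u in Set.Ioi (0:ℝ), (b u : ℂ) * Complex.exp (-z * u))
    {lam : ℝ} (hl : 0 < lam) {δ : ℝ} (hδ : 0 < δ) (y : ℝ) :
    ∫ u in Set.Ioi (0:ℝ), ((b u * exp (-δ * u) * (lam * Kf (lam * (y - u))) : ℝ) : ℂ)
      = ∫ t : ℝ, (tri (t / lam) : ℂ) * Complex.exp (Complex.I * t * y) * G (δ + Complex.I * t) := by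
  have h1 : ∀ t : ℝ, (tri (t / lam) : ℂ) * Complex.exp (Complex.I * t * y) * G (δ + Complex.I * t)
      = ∫ u in Set.Ioi (0:ℝ), (tri (t / lam) : ℂ) * ((b u * exp (-δ * u) : ℝ) : ℂ)
          * Complex.exp (Complex.I * t * ((y - u : ℝ) : ℂ)) := by
    intro t
    rw [hGb _ (by simpa using hδ), ← integral_const_mul]
    congr 1
    ext u
    push_cast
    have : Complex.exp (Complex.I * t * y) * Complex.exp (-(δ + Complex.I * t) * u)
        = Complex.exp (-δ * u) * Complex.exp (Complex.I * t * (y - u)) := by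
      rw [← Complex.exp_add, ← Complex.exp_add]; congr 1; ring
    linear_combination (tri (t / lam) : ℂ) * b u * this
  simp_rw [h1]
  rw [integral_integral_swap]
  · congr 1
    ext u
    have : ∀ t : ℝ, (tri (t / lam) : ℂ) * ((b u * exp (-δ * u) : ℝ) : ℂ)
          * Complex.exp (Complex.I * t * ((y - u : ℝ) : ℂ)) = ((b u * exp (-δ * u) : ℝ) : ℂ) *
          ((tri (t / lam) : ℂ) * Complex.exp (Complex.I * t * ((y - u : ℝ) : ℂ))) := by
      intro t; ring
    simp_rw [this]
    rw [integral_const_mul, Kf_complex_scale hl]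
    push_cast; ring
  · have hi : Integrable (fun u => C * exp (-δ * u)) (volume.restrict (Set.Ioi (0:ℝ))) :=
      (exp_neg_integrableOn_Ioi 0 hδ).const_mul C
    have := (tri_scale_int hl).mul_prod hi
    refine Integrable.mono' this ?_ ?_
    · apply Measurable.aestronglyMeasurable
      have := (tri_scale_cont lam).measurable
      have h3 : Measurable fun t : ℝ => tri (t / lam) := this
      have h4 : Measurable fun p : ℝ × ℝ => (tri (p.1 / lam) : ℂ) :=
        Complex.measurable_ofReal.comp (h3.comp measurable_fst)
      have h5 : Measurable fun p : ℝ × ℝ => ((b p.2 * exp (-δ * p.2) : ℝ) : ℂ) :=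
        Complex.measurable_ofReal.comp (by fun_prop)
      have h6 : Measurable fun p : ℝ × ℝ => Complex.exp (Complex.I * p.1 * ((y - p.2 : ℝ) : ℂ)) :=
        Continuous.measurable (by fun_prop)
      exact (h4.mul h5).mul h6
    · refine Eventually.of_forall fun ⟨t, u⟩ => ?_
      simp only [Function.uncurry]
      rw [norm_mul, norm_mul, Complex.norm_real, Complex.norm_real,
        show Complex.I * t * ((y - u : ℝ) : ℂ) = ((t * (y - u) : ℝ) : ℂ) * Complex.I by
          push_cast; ring, Complex.norm_exp_ofReal_mul_I, mul_one, norm_mul,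
          Real.norm_of_nonneg (tri_nonneg _), Real.norm_of_nonneg (exp_pos _).le]
      have := hb u
      have := tri_nonneg (t / lam)
      rw [Real.norm_eq_abs]
      gcongr

lemma taub {b : ℝ → ℝ} (hbm : Measurable b) {C : ℝ} (hb : ∀ u, |b u| ≤ C)
    {G : ℂ → ℂ} (hG : ContinuousOn G {z | 0 ≤ z.re}) (hGb : ∀ z : ℂ, 0 < z.re →
      G z = ∫ u in Set.Ioi (0:ℝ), (b u : ℂ) * Complex.exp (-z * u))
    {lam : ℝ} (hl : 0 < lam) :
    Tendsto (fun y : ℝ => ∫ u in Set.Ioi (0:ℝ), b u * (lam * Kf (lam * (y - u)))) atTop (𝓝 0) := by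
  have hC : 0 ≤ C := (abs_nonneg _).trans (hb 0)
  have key : ∀ y : ℝ, ((∫ u in Set.Ioi (0:ℝ), b u * (lam * Kf (lam * (y - u))) : ℝ) : ℂ)
      = ∫ t : ℝ, (tri (t / lam) : ℂ) * Complex.exp (Complex.I * t * y) * G (Complex.I * t) := by
    intro y
    let d : ℕ → ℝ := fun n => 1 / ((n : ℝ) + 1)
    have hd0 : ∀ n, 0 < d n := fun n => by positivity
    have hd1 : ∀ n, d n ≤ 1 := fun n => by
      simp only [d]; rw [div_le_one (by positivity)]; linarith [Nat.cast_nonneg (α := ℝ) n]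
    have hd : Tendsto d atTop (𝓝 0) := tendsto_one_div_add_atTop_nhds_zero_nat
    have hK : Integrable fun u => lam * Kf (lam * (y - u)) := by
      have h1 : Integrable fun u => Kf (lam * u) := Kf_int.comp_mul_left' hl.ne'
      exact (h1.comp_sub_left y).const_mul lam
    have L : Tendsto (fun n => ∫ u in Set.Ioi (0:ℝ),
        ((b u * exp (-d n * u) * (lam * Kf (lam * (y - u))) : ℝ) : ℂ)) atTop
        (𝓝 (∫ u in Set.Ioi (0:ℝ), ((b u * (lam * Kf (lam * (y - u))) : ℝ) : ℂ))) := by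
      apply tendsto_integral_of_dominated_convergence
        (fun u => C * (lam * Kf (lam * (y - u))))
      · intro n
        apply Complex.continuous_ofReal.comp_aestronglyMeasurable
        apply AEStronglyMeasurable.mul _ hK.aestronglyMeasurable.restrict
        apply Measurable.aestronglyMeasurable
        fun_prop
      · exact (hK.const_mul C).restrict
      · intro n
        filter_upwards [self_mem_ae_restrict measurableSet_Ioi] with u hu
        have hk : 0 ≤ lam * Kf (lam * (y - u)) := mul_nonneg hl.le (Kf_nonneg _)
        rw [Complex.norm_real, norm_mul, norm_mul, Real.norm_of_nonneg (exp_pos _).le,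
          Real.norm_of_nonneg hk, Real.norm_eq_abs]
        have h2 : exp (-d n * u) ≤ 1 := by
          rw [exp_le_one_iff]; have := hd0 n; have : (0:ℝ) < u := hu; nlinarith
        have := hb u
        have := abs_nonneg (b u)
        have := (exp_pos (-d n * u)).le
        gcongr
        nlinarith
      · refine Eventually.of_forall fun u => ?_
        apply (Complex.continuous_ofReal.tendsto _).comp
        have h3 : Tendsto (fun n => exp (-d n * u)) atTop (𝓝 1) := by
          have := (hd.neg.mul_const u)
          have h4 := (Real.continuous_exp.tendsto _).comp this
          simpa [Function.comp_def] using h4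
        have := (h3.const_mul (b u)).mul_const (lam * Kf (lam * (y - u)))
        simpa using this
    have R : Tendsto (fun n => ∫ t : ℝ, (tri (t / lam) : ℂ) * Complex.exp (Complex.I * t * y)
        * G (d n + Complex.I * t)) atTop
        (𝓝 (∫ t : ℝ, (tri (t / lam) : ℂ) * Complex.exp (Complex.I * t * y)
          * G (Complex.I * t))) := by
      let φ : ℝ × ℝ → ℂ := fun p => p.1 + Complex.I * p.2
      have hφ : Continuous φ := by fun_prop
      have hcomp : IsCompact (φ '' (Set.Icc 0 1 ×ˢ Set.Icc (-lam) lam)) :=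
        (isCompact_Icc.prod isCompact_Icc).image hφ
      obtain ⟨B, hB⟩ := hcomp.exists_bound_of_continuousOn (f := G) (hG.mono (by
        rintro _ ⟨⟨a, t⟩, ⟨ha, _⟩, rfl⟩
        simpa [φ] using ha.1))
      apply tendsto_integral_of_dominated_convergence (fun t => tri (t / lam) * B)
      · intro n
        apply AEStronglyMeasurable.mul
        · apply Continuous.aestronglyMeasurable
          have := tri_scale_cont lam
          fun_prop
        · apply Continuous.aestronglyMeasurable
          apply hG.comp_continuous (by fun_prop)
          intro t; simpa using (hd0 n).le
      · exact (tri_scale_int hl).mul_const B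
      · intro n
        refine Eventually.of_forall fun t => ?_
        by_cases ht : t ∈ Set.Icc (-lam) lam
        · rw [norm_mul, norm_mul, Complex.norm_real, Real.norm_of_nonneg (tri_nonneg _),
            show Complex.I * t * (y : ℂ) = ((t * y : ℝ) : ℂ) * Complex.I by
              push_cast; ring, Complex.norm_exp_ofReal_mul_I, mul_one]
          have := tri_nonneg (t / lam)
          gcongr
          exact hB _ ⟨(d n, t), ⟨⟨(hd0 n).le, hd1 n⟩, ht⟩, rfl⟩
        · simp [tri_scale_zero hl ht]
      · refine Eventually.of_forall fun t => ?_
        apply Tendsto.const_mul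
        have h5 : Tendsto G (𝓝[{z | 0 ≤ z.re}] (Complex.I * t)) (𝓝 (G (Complex.I * t))) :=
          hG _ (by simp)
        apply h5.comp
        rw [tendsto_nhdsWithin_iff]
        constructor
        · have h6 : Tendsto (fun n => (d n : ℂ)) atTop (𝓝 0) := by
            simpa [Function.comp_def] using (Complex.continuous_ofReal.tendsto _).comp hd
          simpa using h6.add_const (Complex.I * t)
        · exact Eventually.of_forall fun n => by simpa using (hd0 n).le
    rw [← integral_complex_ofReal]
    refine tendsto_nhds_unique L ?_
    refine R.congr fun n => ?_
    rw [taub_fubini hbm hb hGb hl (hd0 n) y]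
  have RL := Real.tendsto_integral_exp_smul_cocompact
    (fun t : ℝ => (tri (t / lam) : ℂ) * G (Complex.I * t))
  have hy : Tendsto (fun y : ℝ => -y / (2 * π)) atTop (cocompact ℝ) := by
    apply Tendsto.mono_right _ atBot_le_cocompact
    apply Tendsto.atBot_div_const (by positivity)
    exact tendsto_neg_atTop_atBot
  have RL2 := RL.comp hy
  have h7 : Tendsto (fun y : ℝ =>
      ((∫ u in Set.Ioi (0:ℝ), b u * (lam * Kf (lam * (y - u))) : ℝ) : ℂ)) atTop (𝓝 0) := by
    refine RL2.congr fun y => ?_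
    rw [key y]
    simp only [Function.comp]
    congr 1
    ext t
    rw [Circle.smul_def, Real.fourierChar_apply, smul_eq_mul]
    have : ((2 * π * (-(t * (-y / (2 * π)))) : ℝ) : ℂ) * Complex.I = Complex.I * t * y := by
      have : 2 * π * (-(t * (-y / (2 * π)))) = t * y := by field_simp
      rw [this]; push_cast; ring
    rw [this]; ring
  have := (Complex.continuous_re.tendsto _).comp h7
  simpa [Function.comp_def] using this

end CB

namespace CB
open MeasureTheory Topology

/-- `ψ(e^u) e^{-u}`. -/
noncomputable def hh (u : ℝ) : ℝ := Chebyshev.psi (exp u) * exp (-u)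

lemma hh_nonneg (u : ℝ) : 0 ≤ hh u := mul_nonneg (Chebyshev.psi_nonneg _) (exp_pos _).le

lemma hh_le (u : ℝ) : hh u ≤ log 4 + 4 := by
  have := Chebyshev.psi_le_const_mul_self (exp_pos u).le
  unfold hh
  calc _ ≤ (log 4 + 4) * exp u * exp (-u) := by gcongr
    _ = _ := by rw [mul_assoc, ← exp_add]; simp

lemma hh_meas : Measurable hh := by
  have h1 : Measurable Chebyshev.psi := Chebyshev.psi_mono.measurable
  exact (h1.comp measurable_exp).mul (by fun_prop)

lemma hh_slow {u v : ℝ} (h : u ≤ v) : hh u ≤ exp (v - u) * hh v := by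
  unfold hh
  have : Chebyshev.psi (exp u) ≤ Chebyshev.psi (exp v) := Chebyshev.psi_mono (exp_le_exp.mpr h)
  calc _ ≤ Chebyshev.psi (exp v) * exp (-u) := by gcongr
    _ = _ := by rw [show -u = (v - u) + (-v) by ring, exp_add]; ring

lemma laplace_hh {z : ℂ} (hz : 0 < z.re) :
    LSeries (fun n => (ArithmeticFunction.vonMangoldt n : ℂ)) (z + 1)
      = (z + 1) * ∫ u in Set.Ioi (0:ℝ), (hh u : ℂ) * Complex.exp (-z * u) := by
  rw [LSeries_eq_mul_integral_of_nonneg (fun n => ArithmeticFunction.vonMangoldt n) (r := 1)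
    zero_le_one (by simpa using hz) ?_ (fun n => ArithmeticFunction.vonMangoldt_nonneg)]
  · congr 1
    have him : Set.Ioi (1:ℝ) = exp '' Set.Ioi 0 := by
      ext x
      constructor
      · intro hx
        have hx' : (1:ℝ) < x := hx
        exact ⟨log x, log_pos hx', exp_log (by linarith)⟩
      · rintro ⟨u, hu, rfl⟩
        exact one_lt_exp_iff.mpr hu
    rw [him, integral_image_eq_integral_abs_deriv_smul measurableSet_Ioi
      (fun x _ => (hasDerivAt_exp x).hasDerivWithinAt) exp_injective.injOn]
    congr 1
    ext u
    have hpsi : (∑ k ∈ Finset.Icc 1 ⌊exp u⌋₊, (ArithmeticFunction.vonMangoldt k : ℂ))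
        = (Chebyshev.psi (exp u) : ℂ) := by
      rw [Chebyshev.psi]; push_cast; rfl
    rw [hpsi, abs_of_pos (exp_pos u), hh]
    rw [Complex.cpow_def_of_ne_zero (by exact_mod_cast (exp_pos u).ne'),
      ← Complex.ofReal_log (exp_pos u).le, log_exp, Complex.real_smul]
    push_cast
    have : Complex.exp u * Complex.exp (u * -(z + 1 + 1)) = Complex.exp (-u) * Complex.exp (-z * u) := by
      rw [← Complex.exp_add, ← Complex.exp_add]; congr 1; ring
    linear_combination (Chebyshev.psi (exp u) : ℂ) * this
  · apply Asymptotics.IsBigO.of_bound (log 4 + 4)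
    refine Eventually.of_forall fun n => ?_
    have h1 := Chebyshev.psi_le_const_mul_self (Nat.cast_nonneg (α := ℝ) n)
    have h2 : ∑ k ∈ Finset.Icc 1 n, ArithmeticFunction.vonMangoldt k = Chebyshev.psi n := by
      rw [Chebyshev.psi, Nat.floor_natCast]; rfl
    rw [h2, Real.norm_of_nonneg (Chebyshev.psi_nonneg _), rpow_one,
      Real.norm_of_nonneg (Nat.cast_nonneg _)]
    exact h1

/-- Boundary function. -/
noncomputable def GG (z : ℂ) : ℂ :=
  (ArithmeticFunction.vonMangoldt.LFunctionResidueClassAux (1 : ZMod 1) (z + 1) - 1) / (z + 1)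

lemma GG_cont : ContinuousOn GG {z | 0 ≤ z.re} := by
  have h := ArithmeticFunction.vonMangoldt.continuousOn_LFunctionResidueClassAux (1 : ZMod 1)
  have h2 : ContinuousOn (fun z : ℂ =>
      ArithmeticFunction.vonMangoldt.LFunctionResidueClassAux (1 : ZMod 1) (z + 1))
      {z | 0 ≤ z.re} := by
    apply h.comp (by fun_prop)
    intro z hz
    have : 0 ≤ z.re := hz
    show 1 ≤ (z + 1).re
    simp [this]
  unfold GG
  apply (h2.sub continuousOn_const).div (by fun_prop)
  intro z hz h0
  have : 0 ≤ z.re := hz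
  have := congrArg Complex.re h0
  simp at this
  linarith

lemma GG_eq (z : ℂ) (hz : 0 < z.re) :
    GG z = ∫ u in Set.Ioi (0:ℝ), ((hh u - 1 : ℝ) : ℂ) * Complex.exp (-z * u) := by
  have hz1 : z + 1 ≠ 0 := by
    intro h0
    have := congrArg Complex.re h0
    simp at this
    linarith
  have hz0 : z ≠ 0 := by rintro rfl; simp at hz
  have hexp : IntegrableOn (fun u : ℝ => Complex.exp (-z * u)) (Set.Ioi 0) := by
    exact integrableOn_exp_mul_complex_Ioi (by simpa using hz) 0
  have hhint : IntegrableOn (fun u : ℝ => (hh u : ℂ) * Complex.exp (-z * u)) (Set.Ioi 0) := by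
    apply Integrable.bdd_mul (c := log 4 + 4) hexp
    · exact (Complex.measurable_ofReal.comp hh_meas).aestronglyMeasurable
    · refine Eventually.of_forall fun u => ?_
      rw [Complex.norm_real, Real.norm_of_nonneg (hh_nonneg u)]
      exact hh_le u
  have h1 : ∫ u in Set.Ioi (0:ℝ), ((hh u - 1 : ℝ) : ℂ) * Complex.exp (-z * u)
      = (∫ u in Set.Ioi (0:ℝ), (hh u : ℂ) * Complex.exp (-z * u)) - 1 / z := by
    have : ∫ u in Set.Ioi (0:ℝ), Complex.exp (-z * u) = 1 / z := by
      rw [integral_exp_mul_complex_Ioi (by simpa using hz)]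
      simp
    rw [← this, ← integral_sub hhint hexp]
    congr 1; ext u; push_cast; ring
  have h2 := ArithmeticFunction.vonMangoldt.eqOn_LFunctionResidueClassAux
    (q := 1) (a := 1) isUnit_one (x := z + 1) (by show 1 < (z + 1).re; simpa using hz)
  have h3 : (fun n : ℕ => ((ArithmeticFunction.vonMangoldt.residueClass (1 : ZMod 1) n : ℝ) : ℂ))
      = fun n => (ArithmeticFunction.vonMangoldt n : ℂ) := by
    ext n
    simp [ArithmeticFunction.vonMangoldt.residueClass, Set.indicator, Subsingleton.elim _ (1 : ZMod 1)]
  simp only at h2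
  rw [h3, laplace_hh hz] at h2
  rw [GG, h2, h1]
  simp
  field_simp
  ring

lemma hh_tauber {lam : ℝ} (hl : 0 < lam) :
    Tendsto (fun y : ℝ => ∫ u in Set.Ioi (0:ℝ), (hh u - 1) * (lam * Kf (lam * (y - u))))
      atTop (𝓝 0) := by
  apply taub (b := fun u => hh u - 1) (hh_meas.sub_const 1) (C := log 4 + 4) ?_ GG_cont GG_eq hl
  intro u
  have := hh_nonneg u
  have := hh_le u
  have : 0 ≤ log 4 := log_nonneg (by norm_num)
  rw [abs_le]; constructor <;> linarith

end CB

namespace CB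
open MeasureTheory Topology

lemma hh_liminf {ε : ℝ} (hε : 0 < ε) (hε1 : ε < 1) : ∀ᶠ y in atTop, 1 - ε ≤ hh y := by
  set c := ∫ w, Kf w with hc
  have hcpos : 0 < c := Kf_integral_pos
  set C := log 4 + 4 with hC
  have hCpos : 0 < C := by have : 0 ≤ log 4 := log_nonneg (by norm_num)
                           linarith
  -- choose parameters
  set κ := ε / (2 * (C + 2)) with hκ
  have hκpos : 0 < κ := by positivity
  set η := ε / 4 with hη
  have hηpos : 0 < η := by positivity
  obtain ⟨R, hRpos, hR⟩ : ∃ R : ℝ, 0 < R ∧ c * (1 - κ) ≤ ∫ w in (-R)..R, Kf w := by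
    have h1 := intervalIntegral_tendsto_integral Kf_int tendsto_neg_atTop_atBot tendsto_id
    have h2 := h1.eventually (Ioi_mem_nhds (show c * (1 - κ) < c by nlinarith))
    obtain ⟨R, hR1, hR2⟩ := (h2.and (eventually_gt_atTop 0)).exists
    exact ⟨R, hR2, le_of_lt hR1⟩
  set lam := R / η with hlam
  have hl : 0 < lam := by positivity
  have hT := hh_tauber hl
  have hT2 := hT.eventually (Ioi_mem_nhds (show -(κ * c) < 0 by
    have := mul_pos hκpos hcpos; linarith))
  have main : ∀ᶠ y in atTop, 1 - ε ≤ hh (y + η) := by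
    filter_upwards [hT2, eventually_gt_atTop η] with y hy hyη
    set Kl : ℝ → ℝ := fun u => lam * Kf (lam * (y - u)) with hKl
    have hKl0 : ∀ u, 0 ≤ Kl u := fun u => mul_nonneg hl.le (Kf_nonneg _)
    have hKint : Integrable Kl := by
      have h1 : Integrable fun u => Kf (lam * u) := Kf_int.comp_mul_left' hl.ne'
      exact (h1.comp_sub_left y).const_mul lam
    have htot : ∫ u, Kl u = c := by
      simp only [hKl]
      rw [integral_const_mul, integral_sub_left_eq_self (fun u => Kf (lam * u)) volume y,
        Measure.integral_comp_mul_left, abs_of_pos (inv_pos.mpr hl), smul_eq_mul, ← mul_assoc,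
        mul_inv_cancel₀ hl.ne', one_mul]
    have hmid : ∫ u in Set.Icc (y - η) (y + η), Kl u = ∫ w in (-R)..R, Kf w := by
      rw [integral_Icc_eq_integral_Ioc, ← intervalIntegral.integral_of_le (by linarith)]
      simp only [hKl]
      rw [intervalIntegral.integral_const_mul,
        intervalIntegral.integral_comp_sub_left (fun u => Kf (lam * u)) y]
      have := intervalIntegral.smul_integral_comp_mul_left (a := -η) (b := η) Kf lam
      rw [smul_eq_mul] at this
      have e1 : y - (y + η) = -η := by ring
      have e2 : y - (y - η) = η := by ring
      have e3 : lam * η = R := by rw [hlam]; field_simp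
      have e4 : lam * -η = -R := by rw [mul_neg, e3]
      rw [e1, e2, this, e3, e4]
    have hpart : c * (1 - κ) ≤ ∫ u in Set.Ioi (0:ℝ), Kl u := by
      refine hR.trans ?_
      rw [← hmid]
      apply setIntegral_mono_set hKint.integrableOn (Eventually.of_forall hKl0)
      apply HasSubset.Subset.eventuallyLE
      intro u hu
      show 0 < u
      linarith [hu.1]
    have hhK : Integrable fun u => hh u * Kl u := by
      apply Integrable.bdd_mul (c := C) hKint hh_meas.aestronglyMeasurable
      refine Eventually.of_forall fun u => ?_
      rw [Real.norm_of_nonneg (hh_nonneg u)]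
      exact hh_le u
    have hsplit : ∫ u in Set.Ioi (0:ℝ), (hh u - 1) * Kl u
        = (∫ u in Set.Ioi (0:ℝ), hh u * Kl u) - ∫ u in Set.Ioi (0:ℝ), Kl u := by
      rw [← integral_sub hhK.integrableOn hKint.integrableOn]
      congr 1; ext u; ring
    have hy' : -(κ * c) < ∫ u in Set.Ioi (0:ℝ), (hh u - 1) * Kl u := hy
    rw [hsplit] at hy'
    have hup1 : ∫ u in Set.Ioi (0:ℝ), hh u * Kl u ≤ ∫ u, hh u * Kl u :=
      setIntegral_le_integral hhK (Eventually.of_forall fun u => mul_nonneg (hh_nonneg u) (hKl0 u))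
    have hup2 : ∫ u, hh u * Kl u ≤ exp (2 * η) * hh (y + η) * c + C * (κ * c) := by
      have hs := integral_add_compl (μ := volume) (s := Set.Icc (y - η) (y + η)) measurableSet_Icc hhK
      have hs2 := integral_add_compl (μ := volume) (s := Set.Icc (y - η) (y + η)) measurableSet_Icc hKint
      have b1 : ∫ u in Set.Icc (y - η) (y + η), hh u * Kl u
          ≤ ∫ u in Set.Icc (y - η) (y + η), exp (2 * η) * hh (y + η) * Kl u := by
        apply setIntegral_mono_on hhK.integrableOn (hKint.const_mul _).integrableOn measurableSet_Icc
        intro u hu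
        have h5 := hh_slow hu.2
        have h6 : exp (y + η - u) ≤ exp (2 * η) := exp_le_exp.mpr (by linarith [hu.1])
        have := hKl0 u
        have := hh_nonneg (y + η)
        gcongr
        exact h5.trans (by gcongr)
      have b2 : ∫ u in (Set.Icc (y - η) (y + η))ᶜ, hh u * Kl u
          ≤ ∫ u in (Set.Icc (y - η) (y + η))ᶜ, C * Kl u := by
        apply setIntegral_mono_on hhK.integrableOn (hKint.const_mul _).integrableOn
          measurableSet_Icc.compl
        intro u hu
        exact mul_le_mul_of_nonneg_right (hh_le u) (hKl0 u)
      rw [integral_const_mul] at b1 b2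
      have b3 : ∫ u in Set.Icc (y - η) (y + η), Kl u ≤ c := by
        rw [← htot]; exact setIntegral_le_integral hKint (Eventually.of_forall hKl0)
      have b4 : ∫ u in (Set.Icc (y - η) (y + η))ᶜ, Kl u ≤ κ * c := by
        rw [htot, hmid] at hs2
        nlinarith
      have b5 : exp (2 * η) * hh (y + η) * ∫ u in Set.Icc (y - η) (y + η), Kl u
          ≤ exp (2 * η) * hh (y + η) * c :=
        mul_le_mul_of_nonneg_left b3 (mul_nonneg (exp_pos _).le (hh_nonneg _))
      have b6 := mul_le_mul_of_nonneg_left b4 hCpos.le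
      linarith
    have h7 : c * (1 - (C + 2) * κ) ≤ c * (exp (2 * η) * hh (y + η)) := by nlinarith
    have h8 := le_of_mul_le_mul_left h7 hcpos
    have h9 : (C + 2) * κ = ε / 2 := by rw [hκ]; field_simp
    rw [h9] at h8
    -- exp(2η) = exp(ε/2), (1-ε) exp(ε/2) ≤ 1 - ε/2
    have h10 : 1 - ε / 2 ≤ exp (-(2 * η)) := by
      have := add_one_le_exp (-(2 * η)); rw [hη] at *; linarith
    have h11 : hh (y + η) = exp (-(2 * η)) * (exp (2 * η) * hh (y + η)) := by
      rw [← mul_assoc, ← exp_add]; simp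
    rw [h11]
    nlinarith [exp_pos (-(2*η))]
  have hs : Tendsto (fun y : ℝ => y - η) atTop atTop := tendsto_atTop_add_const_right _ _ tendsto_id
  filter_upwards [hs.eventually main] with y hy
  simpa using hy

/-- Lower-bound half of the prime number theorem. -/
lemma psi_lower {ε : ℝ} (hε : 0 < ε) (hε1 : ε < 1) :
    ∀ᶠ x : ℝ in atTop, (1 - ε) * x ≤ Chebyshev.psi x := by
  filter_upwards [tendsto_log_atTop.eventually (hh_liminf hε hε1), eventually_gt_atTop 0] with x hx hx0
  unfold hh at hx
  rw [exp_log hx0, exp_neg, exp_log hx0] at hx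
  rwa [← div_eq_mul_inv, le_div_iff₀ hx0] at hx

/-- Lower-bound half of the prime number theorem. -/
lemma primeCounting_lower {ε : ℝ} (hε : 0 < ε) (hε1 : ε < 1) :
    ∀ᶠ x : ℝ in atTop, (1 - ε) * x ≤ (Nat.primeCounting ⌊x⌋₊ : ℝ) * log x := by
  filter_upwards [psi_lower hε hε1] with x hx
  exact hx.trans (Chebyshev.psi_le_primeCounting_mul_log' x)

end CB

namespace CB

lemma emod_ediv_sub (t s : ℤ) {p : ℤ} (hp : 0 < p) :
    (t - s) % p = t % p - s % p + (if t % p < s % p then p else 0) ∧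
    (t - s) / p = t / p - s / p - (if t % p < s % p then 1 else 0) := by
  have h1 := Int.emod_add_mul_ediv t p
  have h2 := Int.emod_add_mul_ediv s p
  have h3 := Int.emod_nonneg t hp.ne'
  have h4 := Int.emod_lt_of_pos t hp
  have h5 := Int.emod_nonneg s hp.ne'
  have h6 := Int.emod_lt_of_pos s hp
  rw [and_comm, Int.ediv_emod_unique hp]
  split_ifs with h
  · refine ⟨by linear_combination h1 - h2, by linarith, by linarith⟩
  · refine ⟨by linear_combination h1 - h2, by linarith, by linarith⟩

/-- the carry in the representation of `m` by `qr, pr, pq` -/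
def FF (p q r x y z m : ℤ) : ℤ := -(m * x / p + m * y / q + m * z / r)

lemma FF_eq {p q r x y z : ℤ} (h : x * (q * r) + y * (p * r) + z * (p * q) = 1) (m : ℤ) :
    (m * x % p) * (q * r) + (m * y % q) * (p * r) + (m * z % r) * (p * q)
      = m + FF p q r x y z m * (p * q * r) := by
  have h1 := Int.emod_add_mul_ediv (m * x) p
  have h2 := Int.emod_add_mul_ediv (m * y) q
  have h3 := Int.emod_add_mul_ediv (m * z) r
  unfold FF
  linear_combination (q * r) * h1 + (p * r) * h2 + (p * q) * h3 + m * h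

lemma FF_nonneg {p q r x y z : ℤ} (hp : 0 < p) (hq : 0 < q) (hr : 0 < r)
    (h : x * (q * r) + y * (p * r) + z * (p * q) = 1) {m : ℤ} (hm : m < p * q * r) :
    0 ≤ FF p q r x y z m := by
  have h0 := FF_eq h m
  have h1 := Int.emod_nonneg (m * x) hp.ne'
  have h2 := Int.emod_nonneg (m * y) hq.ne'
  have h3 := Int.emod_nonneg (m * z) hr.ne'
  have : 0 ≤ m + FF p q r x y z m * (p * q * r) := by rw [← h0]; positivity
  by_contra hneg
  push Not at hneg
  have hN : 0 < p * q * r := by positivity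
  nlinarith

/-- The basic relation `r r* + p p* = pr + 1`. -/
lemma inv_rel {p q r x y z : ℤ} (hp : 1 < p) (hr : 1 < r)
    (h : x * (q * r) + y * (p * r) + z * (p * q) = 1) :
    0 < (q * x) % p ∧ 0 < (q * z) % r ∧ (q * x) % p * r + (q * z) % r * p = p * r + 1 ∧
    q * x / p + q * z / r + y = -1 := by
  have h1 := Int.emod_add_mul_ediv (q * x) p
  have h2 := Int.emod_add_mul_ediv (q * z) r
  have h3 := Int.emod_nonneg (q * x) (by linarith : p ≠ 0)
  have h4 := Int.emod_lt_of_pos (q * x) (by linarith : 0 < p)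
  have h5 := Int.emod_nonneg (q * z) (by linarith : r ≠ 0)
  have h6 := Int.emod_lt_of_pos (q * z) (by linarith : 0 < r)
  have hu : 0 < (q * x) % p := by
    rcases h3.lt_or_eq with h7 | h7
    · exact h7
    · exfalso
      have h8 : p ∣ q * x := Int.dvd_of_emod_eq_zero h7.symm
      have h9 : p ∣ 1 := by
        rw [← h, show x * (q * r) + y * (p * r) + z * (p * q) = (q * x) * r + p * (y * r + z * q) by ring]
        exact dvd_add (h8.mul_right _) (dvd_mul_right _ _)
      have := Int.le_of_dvd one_pos h9
      linarith
  have hw : 0 < (q * z) % r := by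
    rcases h5.lt_or_eq with h7 | h7
    · exact h7
    · exfalso
      have h8 : r ∣ q * z := Int.dvd_of_emod_eq_zero h7.symm
      have h9 : r ∣ 1 := by
        rw [← h, show x * (q * r) + y * (p * r) + z * (p * q) = (q * z) * p + r * (y * p + x * q) by ring]
        exact dvd_add (h8.mul_right _) (dvd_mul_right _ _)
      have := Int.le_of_dvd one_pos h9
      linarith
  set u := (q * x) % p
  set w := (q * z) % r
  set K := q * x / p + q * z / r + y with hK
  have h10 : p * r * K = 1 - (u * r + w * p) := by
    rw [hK]; linear_combination r * h1 + p * h2 + h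
  have hpr : 0 < p * r := by positivity
  have hKm : K = -1 := by
    have ha : u * r + w * p ≤ 2 * (p * r) - r - p := by nlinarith
    have hb : r + p ≤ u * r + w * p := by nlinarith
    have hc : K < 0 := by by_contra hh; push Not at hh; nlinarith
    have hd : -2 < K := by by_contra hh; push Not at hh; nlinarith
    omega
  refine ⟨hu, hw, ?_, hKm⟩
  rw [hKm] at h10
  linarith

lemma FF_sub_q {p q r x y z : ℤ} (hp : 1 < p) (hq : 1 < q) (hr : 1 < r)
    (h : x * (q * r) + y * (p * r) + z * (p * q) = 1) (m : ℤ) :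
    FF p q r x y z (m - q) = FF p q r x y z m - 1 + (if m * x % p < q * x % p then 1 else 0)
      + (if m * z % r < q * z % r then 1 else 0) := by
  have h1 := (emod_ediv_sub (m * x) (q * x) (by linarith : 0 < p)).2
  have h2 := (emod_ediv_sub (m * z) (q * z) (by linarith : 0 < r)).2
  have h3 := (inv_rel hp hr h).2.2.2
  have h4 : (m - q) * y / q = m * y / q - y := by
    rw [show (m - q) * y = m * y + q * (-y) by ring, Int.add_mul_ediv_left _ _ (by linarith)]; ring
  unfold FF
  rw [show (m - q) * x = m * x - q * x by ring, show (m - q) * z = m * z - q * z by ring, h1, h2, h4]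
  linarith

lemma FF_sub_r {p q r x y z : ℤ} (hp : 1 < p) (hq : 1 < q) (hr : 1 < r)
    (h : x * (q * r) + y * (p * r) + z * (p * q) = 1) (m : ℤ) :
    FF p q r x y z (m - r) = FF p q r x y z m - 1 + (if m * x % p < r * x % p then 1 else 0)
      + (if m * y % q < r * y % q then 1 else 0) := by
  have := FF_sub_q (p := p) (q := r) (r := q) (x := x) (y := z) (z := y) hp hr hq
    (by linear_combination h) m
  unfold FF at *
  linarith

/-- the local second difference -/
def ee (p q r x y z m : ℤ) : ℤ :=
  (if FF p q r x y z m = 0 then 1 else 0) - (if FF p q r x y z (m - q) = 0 then 1 else 0)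
  - (if FF p q r x y z (m - r) = 0 then 1 else 0)
  + (if FF p q r x y z (m - q - r) = 0 then 1 else 0)

end CB

namespace CB

lemma ee_core (F F1 F2 F3 B C i1 i2 i3 : ℤ) (hB : B = 0 ∨ B = 1) (hC : C = 0 ∨ C = 1)
    (hi : (i1 = 1 ∧ i2 = 1 ∧ i3 = 1) ∨ (i1 = 1 ∧ i2 = 1 ∧ i3 = 0) ∨ (i1 = 0 ∧ i2 = 1 ∧ i3 = 0)
      ∨ (i1 = 0 ∧ i2 = 0 ∧ i3 = 1) ∨ (i1 = 0 ∧ i2 = 0 ∧ i3 = 0))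
    (h1 : F1 = F - 1 + i1 + C) (h2 : F2 = F - 1 + i2 + B) (h3 : F3 = F2 - 1 + i3 + C)
    (hF : 0 ≤ F) (hF1 : 0 ≤ F1) (hF2 : 0 ≤ F2) (hF3 : 0 ≤ F3) (e : ℤ)
    (he : e = (if F = 0 then 1 else 0) - (if F1 = 0 then 1 else 0) - (if F2 = 0 then 1 else 0)
      + (if F3 = 0 then 1 else 0)) :
    (e ≤ 0 ∨ (e ≤ 1 ∧ ((i1 = 1 ∧ i3 = 0) ∨ (i1 = 0 ∧ i2 = 0 ∧ i3 = 0 ∧ B = 0 ∧ C = 0 ∧ F = 2) ∨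
      (i1 = 1 ∧ i3 = 1 ∧ B = 1 ∧ C = 1 ∧ F = 0)))) ∧
    (-e ≤ 0 ∨ (-e ≤ 1 ∧ ((i2 = 0 ∧ i3 = 1) ∨ (i1 = 0 ∧ i2 = 1 ∧ B = 1 ∧ C = 0 ∧ F = 1)))) := by
  subst h3 h1 h2
  rcases hi with ⟨rfl, rfl, rfl⟩ | ⟨rfl, rfl, rfl⟩ | ⟨rfl, rfl, rfl⟩ | ⟨rfl, rfl, rfl⟩ | ⟨rfl, rfl, rfl⟩ <;>
  rcases hB with rfl | rfl <;> rcases hC with rfl | rfl <;>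
  · obtain hf | hf | hf | hf : F = 0 ∨ F = 1 ∨ F = 2 ∨ 3 ≤ F := by omega
    · subst hf; norm_num at * ; try omega
    · subst hf; norm_num at * ; try omega
    · subst hf; norm_num at * ; try omega
    · split_ifs at he <;> omega


lemma card_le_spread (T : Finset ℤ) (L : ℤ) (h : ∀ s ∈ T, ∀ t ∈ T, s - t < L) :
    (T.card : ℤ) ≤ max L 0 := by
  rcases T.eq_empty_or_nonempty with rfl | hne
  · simp
  · have hsub : T ⊆ Finset.Ico (T.min' hne) (T.min' hne + L) := by
      intro s hs
      have h1 := T.min'_le s hs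
      have h2 := h s hs _ (T.min'_mem hne)
      simp only [Finset.mem_Ico]
      constructor <;> linarith
    have := Finset.card_le_card hsub
    rw [Int.card_Ico] at this
    omega

lemma a_inj {p x : ℤ} {k : ℤ} (hx : IsCoprime p x) {m1 m2 : ℤ}
    (h1 : m1 ∈ Finset.Ioc (k - p) k) (h2 : m2 ∈ Finset.Ioc (k - p) k)
    (h : m1 * x % p = m2 * x % p) : m1 = m2 := by
  have h3 : p ∣ (m1 - m2) * x := by
    rw [sub_mul]; exact Int.ModEq.dvd (Eq.symm h)
  have h4 : p ∣ m1 - m2 := hx.dvd_of_dvd_mul_right h3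
  simp only [Finset.mem_Ioc] at h1 h2
  have h5 : m1 - m2 = 0 := by
    apply Int.eq_zero_of_abs_lt_dvd h4
    rw [abs_lt]; constructor <;> linarith
  linarith

lemma spread_bound {p q r x y z : ℤ} (hp : 1 < p) (hq : 1 < q) (hr : 1 < r)
    (h : x * (q * r) + y * (p * r) + z * (p * q) = 1) {m1 m2 β γ s t : ℤ}
    (hm : m1 - m2 ≤ p - 1) (hF : FF p q r x y z m1 = FF p q r x y z m2)
    (hb : m2 * y % q - m1 * y % q ≤ β - 1) (hc : m2 * z % r - m1 * z % r ≤ γ - 1)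
    (hβ : p * β ≤ q * s + 1) (hγ : p * γ ≤ r * t + 1) :
    m1 * x % p - m2 * x % p < s + t := by
  have e1 := FF_eq h m1
  have e2 := FF_eq h m2
  rw [hF] at e1
  generalize m1 * x % p = a1 at *
  generalize m2 * x % p = a2 at *
  generalize m1 * y % q = b1 at *
  generalize m2 * y % q = b2 at *
  generalize m1 * z % r = c1 at *
  generalize m2 * z % r = c2 at *
  have e3 : (a1 - a2) * (q * r) = (m1 - m2) + (b2 - b1) * (p * r) + (c2 - c1) * (p * q) := by
    linear_combination e1 - e2
  have f1 : (b2 - b1) * (p * r) ≤ (β - 1) * (p * r) :=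
    mul_le_mul_of_nonneg_right hb (by positivity)
  have f2 : (c2 - c1) * (p * q) ≤ (γ - 1) * (p * q) :=
    mul_le_mul_of_nonneg_right hc (by positivity)
  have f3 : p * β * r ≤ (q * s + 1) * r := mul_le_mul_of_nonneg_right hβ (by positivity)
  have f4 : p * γ * q ≤ (r * t + 1) * q := mul_le_mul_of_nonneg_right hγ (by positivity)
  have f5 : (a1 - a2) * (q * r) < (s + t) * (q * r) := by nlinarith
  exact lt_of_mul_lt_mul_right f5 (by positivity)

end CB

namespace CB

set_option maxHeartbeats 2000000 in
lemma ee_point {p q r x y z : ℤ} (hp : 1 < p) (hq : 1 < q) (hr : 1 < r)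
    (h : x * (q * r) + y * (p * r) + z * (p * q) = 1) (huv : q * x % p ≤ r * x % p) {m : ℤ}
    (hm : m < p * q * r) :
    ee p q r x y z m ≤
      (if q * x % p + r * x % p - p ≤ m * x % p ∧ m * x % p < q * x % p then 1 else 0)
      + (if q * x % p + r * x % p ≤ m * x % p ∧ r * y % q ≤ m * y % q ∧ q * z % r ≤ m * z % r ∧
          FF p q r x y z m = 2 then 1 else 0)
      + (if m * x % p < q * x % p + r * x % p - p ∧ m * y % q < r * y % q ∧ m * z % r < q * z % r ∧
          FF p q r x y z m = 0 then 1 else 0) ∧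
    - ee p q r x y z m ≤
      (if r * x % p ≤ m * x % p ∧ m * x % p < q * x % p + r * x % p then 1 else 0)
      + (if q * x % p ≤ m * x % p ∧ m * x % p < r * x % p ∧ m * y % q < r * y % q ∧
          q * z % r ≤ m * z % r ∧ FF p q r x y z m = 1 then 1 else 0) := by
  have hN := FF_nonneg (by linarith) (by linarith) (by linarith) h hm
  have hN1 := FF_nonneg (by linarith) (by linarith) (by linarith) h (m := m - q) (by linarith)
  have hN2 := FF_nonneg (by linarith) (by linarith) (by linarith) h (m := m - r) (by linarith)
  have hN3 := FF_nonneg (by linarith) (by linarith) (by linarith) h (m := m - q - r) (by linarith)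
  have h1 := FF_sub_q hp hq hr h m
  have h2 := FF_sub_r hp hq hr h m
  have h3 := FF_sub_q hp hq hr h (m - r)
  have ea : (m - r) * x % p = m * x % p - r * x % p + (if m * x % p < r * x % p then p else 0) := by
    rw [sub_mul]; exact (emod_ediv_sub (m * x) (r * x) (by linarith : 0 < p)).1
  have ec : (m - r) * z % r = m * z % r := by
    rw [show (m - r) * z = m * z + r * (-z) by ring, Int.add_mul_emod_self_left]
  rw [ea, ec, show m - r - q = m - q - r by ring] at h3
  have a0 := Int.emod_nonneg (m * x) (by linarith : p ≠ 0)
  have a1 := Int.emod_lt_of_pos (m * x) (by linarith : 0 < p)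
  have v1 := Int.emod_lt_of_pos (r * x) (by linarith : 0 < p)
  have u0 := (inv_rel hp hr h).1
  have he := ee.eq_1 p q r x y z m
  generalize ee p q r x y z m = e at *
  generalize FF p q r x y z m = F at *
  generalize FF p q r x y z (m - q) = F1 at *
  generalize FF p q r x y z (m - r) = F2 at *
  generalize FF p q r x y z (m - q - r) = F3 at *
  generalize m * x % p = a at *
  generalize q * x % p = u at *
  generalize r * x % p = v at *
  generalize m * y % q = b at *
  generalize r * y % q = w at *
  generalize m * z % r = c at *
  generalize q * z % r = w' at *
  obtain ⟨B, hB⟩ : ∃ B : ℤ, B = if b < w then 1 else 0 := ⟨_, rfl⟩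
  obtain ⟨C, hC⟩ : ∃ C : ℤ, C = if c < w' then 1 else 0 := ⟨_, rfl⟩
  obtain ⟨i1, hi1⟩ : ∃ C : ℤ, C = if a < u then 1 else 0 := ⟨_, rfl⟩
  obtain ⟨i2, hi2⟩ : ∃ C : ℤ, C = if a < v then 1 else 0 := ⟨_, rfl⟩
  obtain ⟨i3, hi3⟩ : ∃ C : ℤ, C = if a - v + (if a < v then p else 0) < u then 1 else 0 := ⟨_, rfl⟩
  rw [← hB, ← hi2] at h2
  rw [← hC, ← hi1] at h1
  rw [← hC, ← hi3] at h3
  have hB' : (B = 1 ∧ b < w) ∨ (B = 0 ∧ w ≤ b) := by split_ifs at hB <;> omega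
  have hC' : (C = 1 ∧ c < w') ∨ (C = 0 ∧ w' ≤ c) := by split_ifs at hC <;> omega
  have hi : (i1 = 1 ∧ i2 = 1 ∧ i3 = 1 ∧ a < u + v - p) ∨
      (i1 = 1 ∧ i2 = 1 ∧ i3 = 0 ∧ a < u ∧ u + v - p ≤ a) ∨
      (i1 = 0 ∧ i2 = 1 ∧ i3 = 0 ∧ u ≤ a ∧ a < v)
      ∨ (i1 = 0 ∧ i2 = 0 ∧ i3 = 1 ∧ v ≤ a ∧ a < u + v) ∨
      (i1 = 0 ∧ i2 = 0 ∧ i3 = 0 ∧ u + v ≤ a) := by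
    clear hB hC hB' hC' h1 h2 h3 he
    split_ifs at hi2
    all_goals rename_i hh
    all_goals simp only [hh, if_true, if_false] at hi3
    all_goals split_ifs at hi1 hi3 <;> omega
  have key := ee_core F F1 F2 F3 B C i1 i2 i3 (by omega) (by omega) (by omega) h1 h2 h3
    hN hN1 hN2 hN3 e he
  clear hB hC hi1 hi2 hi3 he h1 h2 h3
  obtain ⟨k1, k2⟩ := key
  constructor
  · clear k2
    rcases k1 with k1 | ⟨k0, k1 | k1 | k1⟩
    · split_ifs <;> omega
    · rw [if_pos (by omega)]; split_ifs <;> omega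
    · rw [if_pos (c := _ ∧ _ ∧ _ ∧ F = 2) (by omega)]; split_ifs <;> omega
    · rw [if_pos (c := _ ∧ _ ∧ _ ∧ F = 0) (by omega)]; split_ifs <;> omega
  · clear k1
    rcases k2 with k1 | ⟨k0, k1 | k1⟩
    · split_ifs <;> omega
    · rw [if_pos (by omega)]; split_ifs <;> omega
    · rw [if_pos (c := _ ∧ _ ∧ _ ∧ _ ∧ F = 1) (by omega)]; split_ifs <;> omega

/-- sufficient condition on the inverses -/
def Good (p u v : ℤ) : Prop :=
  3 * (2 * min (min u (p - u)) (min v (p - v)) + max (min u (p - u)) (min v (p - v))) ≤ 2 * p ∨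
  3 * (p - max (min u (p - u)) (min v (p - v))) ≤ 2 * p

set_option maxHeartbeats 2000000 in
lemma window_bound_aux {p q r x y z : ℤ} (hp : 1 < p) (hq : 1 < q) (hr : 1 < r)
    (h : x * (q * r) + y * (p * r) + z * (p * q) = 1) (huv : q * x % p ≤ r * x % p) {k : ℤ}
    (hk : k < p * q * r) (hg : Good p (q * x % p) (r * x % p)) :
    3 * |∑ m ∈ Finset.Ioc (k - p) k, ee p q r x y z m| ≤ 2 * p := by
  have hcop : IsCoprime p x := ⟨y * r + z * q, q * r, by linear_combination h⟩
  obtain ⟨u0, w0, hw1, -⟩ := inv_rel hp hr h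
  obtain ⟨v0, w0', hw2, -⟩ := inv_rel (p := p) (q := r) (r := q) (x := x) (y := z) (z := y) hp hq
    (by linear_combination h)
  have v1 := Int.emod_lt_of_pos (r * x) (by linarith : 0 < p)
  have hcard : ∀ (P : ℤ → Prop) [DecidablePred P] (L : ℤ),
      (∀ m1 ∈ Finset.Ioc (k - p) k, ∀ m2 ∈ Finset.Ioc (k - p) k, P m1 → P m2 →
        m1 * x % p - m2 * x % p < L) →
      ∑ m ∈ Finset.Ioc (k - p) k, (if P m then (1 : ℤ) else 0) ≤ max L 0 := by
    intro P _ L hL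
    rw [Finset.sum_boole]
    have hinj : Set.InjOn (fun m => m * x % p) ((Finset.Ioc (k - p) k).filter P : Finset ℤ) := by
      intro m1 h1 m2 h2 h12
      simp only [Finset.coe_filter, Set.mem_ofPred_eq] at h1 h2
      exact a_inj hcop h1.1 h2.1 h12
    rw [← Finset.card_image_of_injOn hinj]
    apply card_le_spread
    intro s hs t ht
    simp only [Finset.mem_image, Finset.mem_filter] at hs ht
    obtain ⟨m1, ⟨h1, h1'⟩, rfl⟩ := hs
    obtain ⟨m2, ⟨h2, h2'⟩, rfl⟩ := ht
    exact hL m1 h1 m2 h2 h1' h2'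
  have hpt : ∀ m ∈ Finset.Ioc (k - p) k, _ := fun m hm => ee_point hp hq hr h huv (m := m)
    (by simp only [Finset.mem_Ioc] at hm; linarith)
  have S1 := Finset.sum_le_sum fun m hm => (hpt m hm).1
  have S2 := Finset.sum_le_sum fun m hm => (hpt m hm).2
  rw [Finset.sum_add_distrib, Finset.sum_add_distrib] at S1
  rw [Finset.sum_add_distrib, Finset.sum_neg_distrib] at S2
  have ha : ∀ m, 0 ≤ m * x % p ∧ m * x % p < p := fun m =>
    ⟨Int.emod_nonneg _ (by linarith), Int.emod_lt_of_pos _ (by linarith)⟩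
  have hb : ∀ m, 0 ≤ m * y % q ∧ m * y % q < q := fun m =>
    ⟨Int.emod_nonneg _ (by linarith), Int.emod_lt_of_pos _ (by linarith)⟩
  have hc : ∀ m, 0 ≤ m * z % r ∧ m * z % r < r := fun m =>
    ⟨Int.emod_nonneg _ (by linarith), Int.emod_lt_of_pos _ (by linarith)⟩
  have R1a := hcard (fun m => q * x % p + r * x % p - p ≤ m * x % p ∧ m * x % p < q * x % p)
    (q * x % p) (fun m1 _ m2 _ c1 c2 => by have := ha m1; have := ha m2; omega)
  have R1b := hcard (fun m => q * x % p + r * x % p - p ≤ m * x % p ∧ m * x % p < q * x % p)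
    (p - r * x % p) (fun m1 _ m2 _ c1 c2 => by have := ha m1; have := ha m2; omega)
  have R3a := hcard (fun m => r * x % p ≤ m * x % p ∧ m * x % p < q * x % p + r * x % p)
    (q * x % p) (fun m1 _ m2 _ c1 c2 => by have := ha m1; have := ha m2; omega)
  have R3b := hcard (fun m => r * x % p ≤ m * x % p ∧ m * x % p < q * x % p + r * x % p)
    (p - r * x % p) (fun m1 _ m2 _ c1 c2 => by have := ha m1; have := ha m2; omega)
  have Y4a := hcard (fun m => q * x % p + r * x % p ≤ m * x % p ∧ r * y % q ≤ m * y % q ∧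
      q * z % r ≤ m * z % r ∧ FF p q r x y z m = 2)
    (p - q * x % p - r * x % p) (fun m1 _ m2 _ c1 c2 => by have := ha m1; have := ha m2; omega)
  have Y4b := hcard (fun m => q * x % p + r * x % p ≤ m * x % p ∧ r * y % q ≤ m * y % q ∧
      q * z % r ≤ m * z % r ∧ FF p q r x y z m = 2)
    (r * x % p + q * x % p) (fun m1 k1 m2 k2 c1 c2 => by
      have b2 := hb m2; have c2' := hc m2
      simp only [Finset.mem_Ioc] at k1 k2
      exact spread_bound hp hq hr h (by linarith) (by rw [c1.2.2.2, c2.2.2.2])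
        (β := q - r * y % q) (γ := r - q * z % r) (by linarith) (by linarith)
        (by linarith) (by linarith))
  have Y4'a := hcard (fun m => m * x % p < q * x % p + r * x % p - p ∧ m * y % q < r * y % q ∧
      m * z % r < q * z % r ∧ FF p q r x y z m = 0)
    (q * x % p + r * x % p - p) (fun m1 _ m2 _ c1 c2 => by have := ha m1; have := ha m2; omega)
  have Y4'b := hcard (fun m => m * x % p < q * x % p + r * x % p - p ∧ m * y % q < r * y % q ∧
      m * z % r < q * z % r ∧ FF p q r x y z m = 0)
    ((p - r * x % p) + (p - q * x % p)) (fun m1 k1 m2 k2 c1 c2 => by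
      have b2 := hb m1; have c2' := hc m1
      simp only [Finset.mem_Ioc] at k1 k2
      exact spread_bound hp hq hr h (by linarith) (by rw [c1.2.2.2, c2.2.2.2])
        (β := r * y % q) (γ := q * z % r) (by linarith) (by linarith)
        (by linarith) (by linarith))
  have Y2a := hcard (fun m => q * x % p ≤ m * x % p ∧ m * x % p < r * x % p ∧
      m * y % q < r * y % q ∧ q * z % r ≤ m * z % r ∧ FF p q r x y z m = 1)
    (r * x % p - q * x % p) (fun m1 _ m2 _ c1 c2 => by have := ha m1; have := ha m2; omega)
  have Y2b := hcard (fun m => q * x % p ≤ m * x % p ∧ m * x % p < r * x % p ∧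
      m * y % q < r * y % q ∧ q * z % r ≤ m * z % r ∧ FF p q r x y z m = 1)
    ((p - r * x % p) + (q * x % p)) (fun m1 k1 m2 k2 c1 c2 => by
      have b2 := hb m1; have c2' := hc m2
      simp only [Finset.mem_Ioc] at k1 k2
      exact spread_bound hp hq hr h (by linarith) (by rw [c1.2.2.2.2, c2.2.2.2.2])
        (β := r * y % q) (γ := r - q * z % r) (by linarith) (by linarith)
        (by linarith) (by linarith))
  generalize hE : ∑ m ∈ Finset.Ioc (k - p) k, ee p q r x y z m = E at *
  rw [show 3 * |E| = |3 * E| by rw [abs_mul]; rfl, abs_le]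
  clear hE hpt hcard ha hb hc hw1 hw2
  generalize q * x % p = u at *
  generalize r * x % p = v at *
  unfold Good at hg
  clear hcop h
  have S1' : E ≤ min u (p - v) + (min (max (p - u - v) 0) (v + u)) +
     (min (max (u + v - p) 0) ((p - v) + (p - u))) := by omega
  have S2' : - E ≤ min u (p - v) + min (max (v - u) 0) (p - v + u) := by omega
  clear S1 S2 R1a R1b R3a R3b Y4a Y4b Y4'a Y4'b Y2a Y2b
  constructor <;> omega

lemma ee_symm (p q r x y z m : ℤ) : ee p q r x y z m = ee p r q x z y m := by
  have : ∀ m, FF p q r x y z m = FF p r q x z y m := fun m => by unfold FF; ring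
  unfold ee
  rw [this, this, this, this, show m - q - r = m - r - q by ring]
  ring

lemma window_bound {p q r x y z : ℤ} (hp : 1 < p) (hq : 1 < q) (hr : 1 < r)
    (h : x * (q * r) + y * (p * r) + z * (p * q) = 1) {k : ℤ}
    (hk : k < p * q * r) (hg : Good p (q * x % p) (r * x % p)) :
    3 * |∑ m ∈ Finset.Ioc (k - p) k, ee p q r x y z m| ≤ 2 * p := by
  rcases le_total (q * x % p) (r * x % p) with h1 | h1
  · exact window_bound_aux hp hq hr h h1 hk hg
  · rw [Finset.sum_congr rfl fun m _ => ee_symm p q r x y z m]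
    apply window_bound_aux hp hr hq (by linear_combination h) h1 (by linarith)
    unfold Good at *
    rw [min_comm (min (r * x % p) _), max_comm (min (r * x % p) _)]
    exact hg

end CB

namespace CB

/-- coefficient extended by zero to negative indices -/
def ec (P : ℤ[X]) (n : ℤ) : ℤ := if 0 ≤ n then P.coeff n.toNat else 0

lemma ec_natCast (P : ℤ[X]) (n : ℕ) : ec P n = P.coeff n := by simp [ec]
lemma ec_add (P Q : ℤ[X]) (n : ℤ) : ec (P + Q) n = ec P n + ec Q n := by
  unfold ec; split_ifs <;> simp
lemma ec_sub (P Q : ℤ[X]) (n : ℤ) : ec (P - Q) n = ec P n - ec Q n := by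
  unfold ec; split_ifs <;> simp
lemma ec_sum {ι : Type*} (s : Finset ι) (P : ι → ℤ[X]) (n : ℤ) :
    ec (∑ i ∈ s, P i) n = ∑ i ∈ s, ec (P i) n := by
  unfold ec; split_ifs <;> simp
lemma ec_mul_X_pow (P : ℤ[X]) (j : ℕ) (n : ℤ) : ec (P * X ^ j) n = ec P (n - j) := by
  unfold ec
  by_cases h : 0 ≤ n
  · rw [if_pos h, coeff_mul_X_pow']
    by_cases h2 : j ≤ n.toNat
    · rw [if_pos h2, if_pos (by omega)]; congr 1; omega
    · rw [if_neg h2, if_neg (by omega)]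
  · rw [if_neg h, if_neg (by omega)]

/-- box polynomial -/
noncomputable def QQ (p q r : ℕ) : ℤ[X] :=
  (∑ a ∈ Finset.range p, (X ^ (q * r)) ^ a) * (∑ b ∈ Finset.range q, (X ^ (p * r)) ^ b) *
    (∑ c ∈ Finset.range r, (X ^ (p * q)) ^ c)

lemma QQ_coeff {p q r : ℕ} {x y z : ℤ} (hp : 1 < p) (hq : 1 < q) (hr : 1 < r)
    (h : x * (q * r) + y * (p * r) + z * (p * q) = 1) (m : ℕ) :
    (QQ p q r).coeff m = if FF p q r x y z m = 0 then 1 else 0 := by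
  have e1 : QQ p q r = ∑ a ∈ Finset.range p, ∑ b ∈ Finset.range q, ∑ c ∈ Finset.range r,
      X ^ (a * (q * r) + b * (p * r) + c * (p * q)) := by
    unfold QQ
    rw [Finset.sum_mul_sum, Finset.sum_mul]
    refine Finset.sum_congr rfl fun a _ => ?_
    rw [Finset.sum_mul]
    refine Finset.sum_congr rfl fun b _ => ?_
    rw [Finset.mul_sum]
    refine Finset.sum_congr rfl fun c _ => ?_
    rw [← pow_mul, ← pow_mul, ← pow_mul, ← pow_add, ← pow_add]
    congr 1; ring
  have hF := FF_eq h (m : ℤ)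
  have a0 := Int.emod_nonneg (m * x) (by omega : (p : ℤ) ≠ 0)
  have a1 := Int.emod_lt_of_pos (m * x) (by omega : 0 < (p : ℤ))
  have b0 := Int.emod_nonneg (m * y) (by omega : (q : ℤ) ≠ 0)
  have b1 := Int.emod_lt_of_pos (m * y) (by omega : 0 < (q : ℤ))
  have c0 := Int.emod_nonneg (m * z) (by omega : (r : ℤ) ≠ 0)
  have c1 := Int.emod_lt_of_pos (m * z) (by omega : 0 < (r : ℤ))
  have key : ∀ a ∈ Finset.range p, ∀ b ∈ Finset.range q, ∀ c ∈ Finset.range r,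
      (X ^ (a * (q * r) + b * (p * r) + c * (p * q)) : ℤ[X]).coeff m =
      if a = (m * x % p).toNat then (if b = (m * y % q).toNat then (if c = (m * z % r).toNat then
        (if FF p q r x y z m = 0 then 1 else 0) else 0) else 0) else 0 := by
    intro a ha b hb c hc
    simp only [Finset.mem_range] at ha hb hc
    rw [coeff_X_pow]
    by_cases hm : m = a * (q * r) + b * (p * r) + c * (p * q)
    · have hm' : (m : ℤ) = a * (q * r) + b * (p * r) + c * (p * q) := by exact_mod_cast hm
      have ea : m * x % p = a := by
        rw [show (m : ℤ) * x = a + p * (-a * (y * r + z * q) + x * (b * r + c * q)) by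
          rw [hm']; linear_combination (a : ℤ) * h, Int.add_mul_emod_self_left]
        exact Int.emod_eq_of_lt (by omega) (by omega)
      have eb : m * y % q = b := by
        rw [show (m : ℤ) * y = b + q * (-b * (x * r + z * p) + y * (a * r + c * p)) by
          rw [hm']; linear_combination (b : ℤ) * h, Int.add_mul_emod_self_left]
        exact Int.emod_eq_of_lt (by omega) (by omega)
      have ec : m * z % r = c := by
        rw [show (m : ℤ) * z = c + r * (-c * (y * p + x * q) + z * (b * p + a * q)) by
          rw [hm']; linear_combination (c : ℤ) * h, Int.add_mul_emod_self_left]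
        exact Int.emod_eq_of_lt (by omega) (by omega)
      rw [if_pos hm, if_pos (by omega), if_pos (by omega), if_pos (by omega), if_pos]
      rw [ea, eb, ec, ← hm'] at hF
      have hN : (p : ℤ) * q * r ≠ 0 := by positivity
      have : FF p q r x y z m * (p * q * r) = 0 := by linarith
      exact (mul_eq_zero.mp this).resolve_right hN
    · rw [if_neg hm]
      split_ifs with k1 k2 k3 k4
      · exfalso; apply hm
        rw [k4] at hF
        have : (m : ℤ) = a * (q * r) + b * (p * r) + c * (p * q) := by
          rw [show (a : ℤ) = m * x % p by omega, show (b : ℤ) = m * y % q by omega,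
            show (c : ℤ) = m * z % r by omega]; linarith
        exact_mod_cast this
      all_goals rfl
  rw [e1]
  simp only [finsetSum_coeff]
  rw [Finset.sum_congr rfl fun a ha => Finset.sum_congr rfl fun b hb =>
    Finset.sum_congr rfl fun c hc => key a ha b hb c hc]
  simp only [Finset.sum_ite_irrel, Finset.sum_const_zero]
  rw [Finset.sum_ite_eq', if_pos (by simp; omega), Finset.sum_ite_eq', if_pos (by simp; omega),
    Finset.sum_ite_eq', if_pos (by simp; omega)]

lemma QQ_ec {p q r : ℕ} {x y z : ℤ} (hp : 1 < p) (hq : 1 < q) (hr : 1 < r)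
    (h : x * (q * r) + y * (p * r) + z * (p * q) = 1) (m : ℤ) :
    ec (QQ p q r) m = if FF p q r x y z m = 0 then 1 else 0 := by
  unfold ec
  by_cases hm : 0 ≤ m
  · rw [if_pos hm, QQ_coeff hp hq hr h, Int.toNat_of_nonneg hm]
  · rw [if_neg hm, if_neg]
    intro h0
    have hF := FF_eq h (m : ℤ)
    have a0 := Int.emod_nonneg (m * x) (by omega : (p : ℤ) ≠ 0)
    have b0 := Int.emod_nonneg (m * y) (by omega : (q : ℤ) ≠ 0)
    have c0 := Int.emod_nonneg (m * z) (by omega : (r : ℤ) ≠ 0)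
    rw [h0] at hF
    have : 0 ≤ m * x % p * (q * r) + m * y % q * (p * r) + m * z % r * (p * q) := by positivity
    linarith

lemma cyc_identity {p q r : ℕ} (hp : p.Prime) (hq : q.Prime) (hr : r.Prime) (hpq : p ≠ q)
    (hpr : p ≠ r) (hqr : q ≠ r) :
    cyclotomic (p * q * r) ℤ * (X ^ (p * q * r) - 1) ^ 2 =
      QQ p q r * (∑ j ∈ Finset.range p, X ^ j) * (X ^ q - 1) * (X ^ r - 1) := by
  have i1 : cyclotomic p ℤ * (X - 1) = X ^ p - 1 := by
    have := Fact.mk hp; exact cyclotomic_prime_mul_X_sub_one ℤ p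
  have i2 := congrArg (expand ℤ q) i1
  simp only [map_mul, map_sub, map_one, map_pow, expand_X] at i2
  rw [cyclotomic_expand_eq_cyclotomic_mul hq
    (by intro hd; exact hpq ((Nat.prime_dvd_prime_iff_eq hq hp).mp hd).symm) ℤ] at i2
  have i3 : cyclotomic (p * q) ℤ * (X ^ p - 1) * (X ^ q - 1) = (X ^ (p * q) - 1) * (X - 1) := by
    rw [mul_comm p q, pow_mul, ← i2, ← i1]; ring
  have i4 := congrArg (expand ℤ r) i3
  simp only [map_mul, map_sub, map_one, map_pow, expand_X] at i4
  rw [cyclotomic_expand_eq_cyclotomic_mul hr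
    (by intro hd
        rcases (Nat.Prime.dvd_mul hr).mp hd with hd | hd
        · exact hpr ((Nat.prime_dvd_prime_iff_eq hr hp).mp hd).symm
        · exact hqr ((Nat.prime_dvd_prime_iff_eq hr hq).mp hd).symm) ℤ] at i4
  have g1 := geom_sum_mul (X ^ (q * r) : ℤ[X]) p
  have g2 := geom_sum_mul (X ^ (p * r) : ℤ[X]) q
  have g3 := geom_sum_mul (X ^ (p * q) : ℤ[X]) r
  have g4 := geom_sum_mul (X : ℤ[X]) p
  have e1 : (X : ℤ[X]) ^ (p * q * r) = (X ^ (q * r)) ^ p := by rw [← pow_mul]; congr 1; ring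
  have e2 : (X : ℤ[X]) ^ (p * q * r) = (X ^ (p * r)) ^ q := by rw [← pow_mul]; congr 1; ring
  have e3 : (X : ℤ[X]) ^ (p * q * r) = (X ^ (p * q)) ^ r := by rw [← pow_mul]
  have e4 : ((X : ℤ[X]) ^ r) ^ p = X ^ (p * r) := by rw [← pow_mul]; congr 1; ring
  have e5 : ((X : ℤ[X]) ^ r) ^ q = X ^ (q * r) := by rw [← pow_mul]; congr 1; ring
  have e6 : ((X : ℤ[X]) ^ r) ^ (p * q) = X ^ (p * q * r) := by rw [← pow_mul]; congr 1; ring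
  rw [e4, e5, e6] at i4
  rw [← e1] at g1
  rw [← e2] at g2
  rw [← e3] at g3
  have n1 : (X ^ (p * q * r) - 1 : ℤ[X]) ≠ 0 :=
    (monic_X_pow_sub_C (1 : ℤ) (Nat.mul_pos (Nat.mul_pos hp.pos hq.pos) hr.pos).ne').ne_zero
  have n2 : (X - 1 : ℤ[X]) ≠ 0 := (monic_X_sub_C (1 : ℤ)).ne_zero
  have n3 : (X ^ (p * q) - 1 : ℤ[X]) ≠ 0 :=
    (monic_X_pow_sub_C (1 : ℤ) (Nat.mul_pos hp.pos hq.pos).ne').ne_zero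
  have n4 : (X ^ (p * r) - 1 : ℤ[X]) ≠ 0 :=
    (monic_X_pow_sub_C (1 : ℤ) (Nat.mul_pos hp.pos hr.pos).ne').ne_zero
  have n5 : (X ^ (q * r) - 1 : ℤ[X]) ≠ 0 :=
    (monic_X_pow_sub_C (1 : ℤ) (Nat.mul_pos hq.pos hr.pos).ne').ne_zero
  unfold QQ
  generalize (∑ j ∈ Finset.range p, (X : ℤ[X]) ^ j) = G at *
  generalize (∑ a ∈ Finset.range p, ((X : ℤ[X]) ^ (q * r)) ^ a) = G1 at *
  generalize (∑ a ∈ Finset.range q, ((X : ℤ[X]) ^ (p * r)) ^ a) = G2 at *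
  generalize (∑ a ∈ Finset.range r, ((X : ℤ[X]) ^ (p * q)) ^ a) = G3 at *
  generalize cyclotomic (p * q * r) ℤ = Φ at *
  generalize cyclotomic (p * q) ℤ = Ψ at *
  generalize (X : ℤ[X]) ^ (p * q * r) = XN at *
  generalize (X : ℤ[X]) ^ (p * q) = A at *
  generalize (X : ℤ[X]) ^ (p * r) = B at *
  generalize (X : ℤ[X]) ^ (q * r) = C at *
  generalize (X : ℤ[X]) ^ p = U at *
  generalize (X : ℤ[X]) ^ q = V at *
  generalize (X : ℤ[X]) ^ r = W at *
  have k1 : Φ * (A - 1) * (X - 1) * (B - 1) * (C - 1) = (XN - 1) * (W - 1) * (U - 1) * (V - 1) := by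
    linear_combination (U - 1) * (V - 1) * i4 - Φ * (B - 1) * (C - 1) * i3
  apply mul_left_cancel₀ (mul_ne_zero (mul_ne_zero n1 n2) n1)
  have k2 : G1 * G2 * G3 * ((A - 1) * (B - 1) * (C - 1)) = (XN - 1) ^ 3 := by
    calc _ = (G1 * (C - 1)) * (G2 * (B - 1)) * (G3 * (A - 1)) := by ring
      _ = _ := by rw [g1, g2, g3]; ring
  have k3 : Φ * (X - 1) * (XN - 1) ^ 3 =
      G1 * G2 * G3 * ((XN - 1) * (W - 1) * (U - 1) * (V - 1)) := by
    rw [← k2, ← k1]; ring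
  rw [← g4] at k3
  linear_combination (XN - 1) * k3

lemma cyc_coeff {p q r : ℕ} (hp : p.Prime) (hq : q.Prime) (hr : r.Prime) (hpq : p ≠ q)
    (hpr : p ≠ r) (hqr : q ≠ r) {x y z : ℤ}
    (h : x * (q * r) + y * (p * r) + z * (p * q) = 1) {k : ℕ} (hk : k < p * q * r) :
    (cyclotomic (p * q * r) ℤ).coeff k = ∑ m ∈ Finset.Ioc ((k : ℤ) - p) k, ee p q r x y z m := by
  have hid := congrArg (fun P => ec P k) (cyc_identity hp hq hr hpq hpr hqr)
  have l1 : ec (cyclotomic (p * q * r) ℤ * (X ^ (p * q * r) - 1) ^ 2) k =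
      (cyclotomic (p * q * r) ℤ).coeff k := by
    rw [show cyclotomic (p * q * r) ℤ * (X ^ (p * q * r) - 1) ^ 2 =
      cyclotomic (p * q * r) ℤ + (cyclotomic (p * q * r) ℤ * (X ^ (p * q * r) - 2)) * X ^ (p * q * r)
      by ring, ec_add, ec_mul_X_pow, ec_natCast]
    conv_rhs => rw [← add_zero (coeff _ _)]
    congr 1
    unfold ec
    rw [if_neg]
    have : (k : ℤ) < ((p * q * r : ℕ) : ℤ) := by exact_mod_cast hk
    linarith
  rw [l1] at hid
  rw [hid, show QQ p q r * (∑ j ∈ Finset.range p, X ^ j) * (X ^ q - 1) * (X ^ r - 1) =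
    ∑ j ∈ Finset.range p, (QQ p q r - QQ p q r * X ^ q - QQ p q r * X ^ r + QQ p q r * X ^ q * X ^ r)
      * X ^ j by rw [← Finset.mul_sum]; ring, ec_sum]
  have : Finset.Ioc ((k : ℤ) - p) k = (Finset.range p).image (fun j : ℕ => (k : ℤ) - j) := by
    ext m
    simp only [Finset.mem_Ioc, Finset.mem_image, Finset.mem_range]
    constructor
    · rintro ⟨h1, h2⟩; exact ⟨((k : ℤ) - m).toNat, by omega, by omega⟩
    · rintro ⟨j, h1, rfl⟩; omega
  rw [this, Finset.sum_image (by intro a _ b _ hab; simp only at hab; omega)]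
  refine Finset.sum_congr rfl fun j _ => ?_
  rw [ec_mul_X_pow, ec_add, ec_sub, ec_sub, ec_mul_X_pow, ec_mul_X_pow, ec_mul_X_pow, ec_mul_X_pow,
    QQ_ec hp.one_lt hq.one_lt hr.one_lt h, QQ_ec hp.one_lt hq.one_lt hr.one_lt h,
    QQ_ec hp.one_lt hq.one_lt hr.one_lt h, QQ_ec hp.one_lt hq.one_lt hr.one_lt h]
  unfold ee
  rw [show (k : ℤ) - j - r - q = k - j - q - r by ring]

theorem height_good {p q r : ℕ} (hp : p.Prime) (hq : q.Prime) (hr : r.Prime) (hpq : p ≠ q)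
    (hpr : p ≠ r) (hqr : q ≠ r)
    (hg : Good p ((q : ZMod p)⁻¹.val) ((r : ZMod p)⁻¹.val)) :
    3 * polyHeight (cyclotomic (p * q * r) ℤ) ≤ 2 * p := by
  have := Fact.mk hp
  have cpq := (Nat.coprime_primes hp hq).mpr hpq
  have cpr := (Nat.coprime_primes hp hr).mpr hpr
  have cqr := (Nat.coprime_primes hq hr).mpr hqr
  obtain ⟨x, s, h1⟩ : IsCoprime ((q * r : ℕ) : ℤ) p :=
    Nat.isCoprime_iff_coprime.mpr ((cpq.mul_right cpr).symm)
  obtain ⟨y', z', h2⟩ : IsCoprime (r : ℤ) q := Nat.isCoprime_iff_coprime.mpr cqr.symm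
  push_cast at h1
  have h : x * (q * r) + (s * y') * (p * r) + (s * z') * (p * q) = 1 := by
    linear_combination h1 + s * p * h2
  have hz : (x : ZMod p) * (q * r) = 1 := by
    have := congrArg (Int.cast : ℤ → ZMod p) h1
    push_cast at this
    simpa using this
  have hq0 : (q : ZMod p) ≠ 0 := fun h0 => by simp [h0] at hz
  have hr0 : (r : ZMod p) ≠ 0 := fun h0 => by simp [h0] at hz
  have hu : (q : ℤ) * x % p = ((r : ZMod p)⁻¹.val : ℤ) := by
    rw [← ZMod.val_intCast]
    congr 2
    push_cast
    field_simp
    linear_combination hz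
  have hv : (r : ℤ) * x % p = ((q : ZMod p)⁻¹.val : ℤ) := by
    rw [← ZMod.val_intCast]
    congr 2
    push_cast
    field_simp
    linear_combination hz
  have hb : ∀ k ∈ (cyclotomic (p * q * r) ℤ).support,
      3 * ((cyclotomic (p * q * r) ℤ).coeff k).natAbs ≤ 2 * p := by
    intro k hk
    have hk1 : k < p * q * r := by
      have := le_natDegree_of_mem_supp k hk
      rw [natDegree_cyclotomic] at this
      refine this.trans_lt (Nat.totient_lt _ ?_)
      have := hp.two_le; have := hq.two_le; have := hr.two_le
      nlinarith [Nat.mul_le_mul hp.two_le hq.two_le]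
    rw [cyc_coeff hp hq hr hpq hpr hqr h hk1]
    have := window_bound (p := p) (q := q) (r := r) (k := k) (by exact_mod_cast hp.one_lt)
      (by exact_mod_cast hq.one_lt) (by exact_mod_cast hr.one_lt) h (by exact_mod_cast hk1)
      (by
        rw [hu, hv]
        unfold Good at *
        rw [min_comm (min ((r : ZMod p)⁻¹.val : ℤ) _), max_comm (min ((r : ZMod p)⁻¹.val : ℤ) _)]
        exact hg)
    rw [Int.abs_eq_natAbs] at this
    omega
  have : polyHeight (cyclotomic (p * q * r) ℤ) ≤ 2 * p / 3 := by
    unfold polyHeight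
    apply Finset.sup_le
    intro k hk
    have := hb k hk
    omega
  omega

end CB

namespace CB

/-- lattice points in half of the bad triangle -/
def gset (p n : ℕ) : Finset (ℕ × ℕ) :=
  (Finset.range p ×ˢ Finset.range n).filter
    (fun x => x.1 ≤ x.2 ∧ 3 * x.2 < p ∧ 2 * p < 6 * x.1 + 3 * x.2)

lemma gset_card (p n : ℕ) (hn : 3 * n ≤ p + 2) :
    (108 * (gset p n).card : ℤ) ≤ (max 0 (9 * n - 2 * p : ℤ)) ^ 2 + 117 * n := by
  induction n with
  | zero => simp [gset]
  | succ n ih =>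
    have ih := ih (by omega)
    have hsub : gset p (n + 1) ⊆ gset p n ∪
        (if 2 * p < 9 * n then (Finset.Ioc ((2 * p - 3 * n) / 6) n).image (fun a => (a, n)) else ∅) := by
      rintro ⟨a, b⟩ h
      simp only [gset, Finset.mem_filter, Finset.mem_product, Finset.mem_range, Finset.mem_union] at h ⊢
      by_cases hb : b < n
      · left; omega
      · right
        have : b = n := by omega
        subst this
        rw [if_pos (by omega)]
        simp only [Finset.mem_image, Finset.mem_Ioc, Prod.mk.injEq]
        exact ⟨a, by omega, rfl, trivial⟩
    have h1 := (Finset.card_le_card hsub).trans (Finset.card_union_le _ _)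
    by_cases ht : 2 * p < 9 * n
    · rw [if_pos ht] at h1
      have h2 := h1.trans (Nat.add_le_add_left Finset.card_image_le _)
      rw [Nat.card_Ioc] at h2
      have h3 : 6 * ((gset p (n + 1)).card : ℤ) ≤ 6 * (gset p n).card + (9 * n - 2 * p) + 5 := by omega
      rw [max_eq_right (by omega)] at ih
      rw [max_eq_right (by push_cast; omega)]
      push_cast
      nlinarith
    · rw [if_neg ht] at h1
      have h2 : ((gset p (n + 1)).card : ℤ) ≤ (gset p n).card := by simpa using h1
      rw [max_eq_left (by omega)] at ih
      have := sq_nonneg (max 0 (9 * ((n + 1 : ℕ) : ℤ) - 2 * p))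
      push_cast at *
      linarith

/-- bad pairs of residues -/
def Bd (p : ℕ) (s t : ZMod p) : Prop := s ≠ 0 ∧ t ≠ 0 ∧ ¬ Good p (s⁻¹.val) (t⁻¹.val)

open Classical in
lemma bad_card (p : ℕ) (hp : p.Prime) [NeZero p] :
    ((Finset.univ.filter (fun x : ZMod p × ZMod p => x.1 ≠ 0 ∧ x.2 ≠ 0 ∧ ¬ Good p x.1.val x.2.val)).card : ℝ)
      ≤ 2 / 27 * p ^ 2 + 20 * p := by
  have := Fact.mk hp
  set A := Finset.univ.filter (fun x : ZMod p × ZMod p => x.1 ≠ 0 ∧ x.2 ≠ 0 ∧ ¬ Good p x.1.val x.2.val)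
  set n := (p + 2) / 3
  set H := gset p n ∪ (gset p n).image Prod.swap
  set f : ZMod p × ZMod p → ℕ × ℕ := fun x => (min x.1.val (p - x.1.val), min x.2.val (p - x.2.val))
  have hmaps : ∀ x ∈ A, f x ∈ H := by
    rintro ⟨s, t⟩ hx
    replace hx := (Finset.mem_filter.mp hx).2
    simp only [Good] at hx
    have hs := ZMod.val_lt s
    have ht := ZMod.val_lt t
    simp only [H, f, Finset.mem_union, gset, Finset.mem_image, Finset.mem_filter,
      Finset.mem_product, Finset.mem_range, Prod.exists, Prod.swap_prod_mk, Prod.mk.injEq]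
    obtain ⟨-, -, hx⟩ := hx
    generalize s.val = s at *
    generalize t.val = t at *
    rcases le_total (min s (p - s)) (min t (p - t)) with h | h
    · left; omega
    · right; exact ⟨min t (p - t), min s (p - s), by omega, rfl, rfl⟩
  have hfib : ∀ y ∈ H, (A.filter (fun x => f x = y)).card ≤ 4 := by
    rintro ⟨a, b⟩ -
    have hsub : A.filter (fun x => f x = (a, b)) ⊆
        ({(a : ZMod p), -(a : ZMod p)} : Finset (ZMod p)) ×ˢ ({(b : ZMod p), -(b : ZMod p)} : Finset (ZMod p)) := by
      rintro ⟨s, t⟩ hx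
      simp only [f, Finset.mem_filter, Prod.mk.injEq] at hx
      have aux : ∀ (s : ZMod p) (a : ℕ), min s.val (p - s.val) = a → s = a ∨ s = -(a : ZMod p) := by
        intro s a h
        have hs := ZMod.val_lt s
        rcases le_total s.val (p - s.val) with h1 | h1
        · left; rw [← h, min_eq_left h1, ZMod.natCast_zmod_val]
        · right; rw [← h, min_eq_right h1, Nat.cast_sub hs.le, ZMod.natCast_zmod_val]; simp
      simp only [Finset.mem_product, Finset.mem_insert, Finset.mem_singleton]
      exact ⟨aux s a hx.2.1, aux t b hx.2.2⟩
    refine (Finset.card_le_card hsub).trans ?_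
    rw [Finset.card_product]
    exact Nat.mul_le_mul Finset.card_le_two Finset.card_le_two
  have h1 := Finset.card_le_mul_card_image_of_maps_to hmaps 4 hfib
  have h2 : H.card ≤ 2 * (gset p n).card := by
    refine (Finset.card_union_le _ _).trans ?_
    have := Finset.card_image_le (s := gset p n) (f := Prod.swap)
    omega
  have h3 := gset_card p n (by omega)
  have h4 : (max 0 (9 * n - 2 * p : ℤ)) ^ 2 ≤ (p + 6) ^ 2 := by
    apply pow_le_pow_left₀ (le_max_left _ _)
    omega
  have h5 : (108 * A.card : ℤ) ≤ 8 * ((p + 6) ^ 2 + 117 * p) := by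
    have : (A.card : ℤ) ≤ 8 * (gset p n).card := by omega
    have hn : (n : ℤ) ≤ p := by have := hp.two_le; omega
    linarith
  have h6 : (108 * A.card : ℝ) ≤ 8 * ((p + 6) ^ 2 + 117 * p) := by exact_mod_cast h5
  have hp2 : (2 : ℝ) ≤ p := by exact_mod_cast hp.two_le
  nlinarith

open Classical in
/-- indicator of bad pairs -/
noncomputable def bd (p : ℕ) (s t : ZMod p) : ℝ := if Bd p s t then 1 else 0

lemma bd_nonneg (p : ℕ) (s t : ZMod p) : 0 ≤ bd p s t := by unfold bd; split_ifs <;> norm_num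
lemma bd_le_one (p : ℕ) (s t : ZMod p) : bd p s t ≤ 1 := by unfold bd; split_ifs <;> norm_num

lemma bd_sum (p : ℕ) (hp : p.Prime) [NeZero p] :
    ∑ s : ZMod p, ∑ t : ZMod p, bd p s t ≤ 2 / 27 * p ^ 2 + 20 * p := by
  classical
  have := Fact.mk hp
  refine le_trans (le_of_eq ?_) (bad_card p hp)
  rw [← Finset.sum_product', ← Finset.sum_boole]
  rw [Finset.univ_product_univ]
  refine Fintype.sum_equiv ((Equiv.inv (ZMod p)).prodCongr (Equiv.inv (ZMod p))) _ _ ?_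
  rintro ⟨s, t⟩
  simp [bd, Bd]

end CB

namespace CB

lemma sum_range_zmod (N : ℕ) [NeZero N] (G : ZMod N → ℝ) :
    ∑ n ∈ Finset.range N, G n = ∑ s : ZMod N, G s := by
  refine Finset.sum_nbij' (fun n => (n : ZMod N)) ZMod.val ?_ ?_ ?_ ?_ ?_
  · intro a _; simp
  · intro a _; simpa using ZMod.val_lt a
  · intro a ha; simp only [Finset.mem_range] at ha; exact ZMod.val_cast_of_lt ha
  · intro a _; simp
  · intro a _; rfl

lemma sum_prod_range {p p' : ℕ} (hp : p.Prime) (hp' : p'.Prime) (hne : p ≠ p')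
    (f : ZMod p → ℝ) (g : ZMod p' → ℝ) :
    ∑ n ∈ Finset.range (p * p'), f n * g n =
      (∑ n ∈ Finset.range p, f n) * (∑ n ∈ Finset.range p', g n) := by
  have := Fact.mk hp
  have := Fact.mk hp'
  have hc : Nat.Coprime p p' := (Nat.coprime_primes hp hp').mpr hne
  have : NeZero (p * p') := ⟨(Nat.mul_pos hp.pos hp'.pos).ne'⟩
  have e1 : ∑ n ∈ Finset.range (p * p'), f n * g n = ∑ n ∈ Finset.range (p * p'),
      (fun s : ZMod (p * p') => f (ZMod.chineseRemainder hc s).1 * g (ZMod.chineseRemainder hc s).2) n := by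
    refine Finset.sum_congr rfl fun n _ => ?_
    simp only [map_natCast, Prod.fst_natCast, Prod.snd_natCast]
  rw [e1, sum_range_zmod (p * p') (fun s : ZMod (p * p') => f (ZMod.chineseRemainder hc s).1 * g (ZMod.chineseRemainder hc s).2), sum_range_zmod, sum_range_zmod, Finset.sum_mul_sum, ← Finset.sum_product',
    Finset.univ_product_univ]
  exact Fintype.sum_equiv (ZMod.chineseRemainder hc).toEquiv _ _ (fun s => rfl)

lemma sum_period (N : ℕ) (g : ℕ → ℝ) (hper : ∀ n, g (n + N) = g n)
    (h0 : ∑ n ∈ Finset.range N, g n = 0) (a : ℕ) : ∑ n ∈ Finset.Ico a (a + N), g n = 0 := by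
  induction a with
  | zero => simpa using h0
  | succ a ih =>
    rcases Nat.eq_zero_or_pos N with rfl | hN
    · simp
    have h1 := Finset.sum_Ico_succ_top (show a ≤ a + N by omega) g
    have h2 := Finset.sum_eq_sum_Ico_succ_bot (show a < a + N + 1 by omega) g
    rw [ih, h2, hper] at h1
    rw [show a + 1 + N = a + N + 1 by ring]
    linarith

lemma sum_interval_bound (N : ℕ) (hN : 0 < N) (g : ℕ → ℝ) (hper : ∀ n, g (n + N) = g n)
    (h0 : ∑ n ∈ Finset.range N, g n = 0) (hg : ∀ n, |g n| ≤ 1) (a l : ℕ) :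
    |∑ n ∈ Finset.Ico a (a + l), g n| ≤ N := by
  induction l using Nat.strong_induction_on with
  | _ l ih =>
    by_cases h : l < N
    · calc _ ≤ ∑ n ∈ Finset.Ico a (a + l), |g n| := Finset.abs_sum_le_sum_abs _ _
        _ ≤ ∑ n ∈ Finset.Ico a (a + l), 1 := Finset.sum_le_sum fun n _ => hg n
        _ = l := by simp
        _ ≤ N := by exact_mod_cast h.le
    · have h1 := ih (l - N) (by omega)
      rw [← Finset.sum_Ico_consecutive g (show a ≤ a + (l - N) by omega)
        (show a + (l - N) ≤ a + l by omega)]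
      have h2 := sum_period N g hper h0 (a + (l - N))
      rw [show a + (l - N) + N = a + l by omega] at h2
      rw [h2, add_zero]
      exact h1

lemma sum_Ioc_bound (N : ℕ) (hN : 0 < N) (g : ℕ → ℝ) (hper : ∀ n, g (n + N) = g n)
    (h0 : ∑ n ∈ Finset.range N, g n = 0) (hg : ∀ n, |g n| ≤ 1) (a b : ℕ) :
    |∑ n ∈ Finset.Ioc a b, g n| ≤ N := by
  have e : Finset.Ioc a b = Finset.Ico (a + 1) (a + 1 + (b - a)) := by
    ext n; simp only [Finset.mem_Ioc, Finset.mem_Ico]; omega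
  rw [e]
  exact sum_interval_bound N hN g hper h0 hg _ _

lemma dispersion (PP : Finset ℕ) (P0 P X : ℝ) (hP0 : 0 < P0) (hX : 0 ≤ X)
    (hPP : ∀ p ∈ PP, p.Prime ∧ P0 ≤ p ∧ (p : ℝ) ≤ P) (f : ∀ p : ℕ, ZMod p → ℝ)
    (hf : ∀ p ∈ PP, ∀ s, |f p s| ≤ 1) (hf0 : ∀ p ∈ PP, ∑ n ∈ Finset.range p, f p n = 0)
    (A B : ℕ → ℕ) (hB : ∀ p ∈ PP, (B p : ℝ) ≤ X / p) (S : ℕ → Prop) [DecidablePred S] :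
    (∑ p ∈ PP, ∑ n ∈ (Finset.Ioc (A p) (B p)).filter S, f p n) ^ 2 ≤
      X / P0 * (∑ p ∈ PP, X / p + P ^ 4) := by
  set M := ⌊X / P0⌋₊
  have hM : (M : ℝ) ≤ X / P0 := Nat.floor_le (by positivity)
  have hsubM : ∀ p ∈ PP, Finset.Ioc (A p) (B p) ⊆ Finset.Ioc 0 M := by
    intro p hp n hn
    simp only [Finset.mem_Ioc] at hn ⊢
    refine ⟨by omega, Nat.le_floor ?_⟩
    have h1 : (n : ℝ) ≤ B p := by exact_mod_cast hn.2
    refine h1.trans ((hB p hp).trans ?_)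
    exact div_le_div_of_nonneg_left hX hP0 (hPP p hp).2.1
  set h : ℕ → ℕ → ℝ := fun p n => if n ∈ Finset.Ioc (A p) (B p) then f p n else 0
  have e1 : ∑ p ∈ PP, ∑ n ∈ (Finset.Ioc (A p) (B p)).filter S, f p n =
      ∑ n ∈ Finset.Ioc 0 M, (if S n then 1 else 0) * ∑ p ∈ PP, h p n := by
    simp_rw [Finset.mul_sum]
    rw [Finset.sum_comm]
    refine Finset.sum_congr rfl fun p hp => ?_
    rw [Finset.sum_filter]
    rw [← Finset.sum_subset (hsubM p hp)]
    · refine Finset.sum_congr rfl fun n hn => ?_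
      simp only [h, if_pos hn]; split_ifs <;> simp
    · intro n _ hn
      simp only [h, if_neg hn, mul_zero]
  rw [e1]
  have cs := Finset.sum_mul_sq_le_sq_mul_sq (Finset.Ioc 0 M) (fun n => if S n then (1 : ℝ) else 0)
    (fun n => ∑ p ∈ PP, h p n)
  refine cs.trans ?_
  have c1 : ∑ n ∈ Finset.Ioc 0 M, (if S n then (1 : ℝ) else 0) ^ 2 ≤ X / P0 := by
    calc _ ≤ ∑ n ∈ Finset.Ioc 0 M, (1 : ℝ) := by
          refine Finset.sum_le_sum fun n _ => ?_
          split_ifs <;> norm_num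
      _ = M := by simp
      _ ≤ _ := hM
  have c2 : ∑ n ∈ Finset.Ioc 0 M, (∑ p ∈ PP, h p n) ^ 2 ≤ ∑ p ∈ PP, X / p + P ^ 4 := by
    have e2 : ∑ n ∈ Finset.Ioc 0 M, (∑ p ∈ PP, h p n) ^ 2 =
        ∑ p ∈ PP, ∑ p' ∈ PP, ∑ n ∈ Finset.Ioc 0 M, h p n * h p' n := by
      simp_rw [sq, Finset.sum_mul_sum]
      rw [Finset.sum_comm]
      refine Finset.sum_congr rfl fun p _ => ?_
      rw [Finset.sum_comm]
    have e3 : ∀ p ∈ PP, ∀ p' ∈ PP, ∑ n ∈ Finset.Ioc 0 M, h p n * h p' n ≤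
        (if p = p' then X / p else 0) + P ^ 2 := by
      intro p hp p' hp'
      have hPpos : 0 ≤ P := by
        have := hPP p hp
        have h1 : (0 : ℝ) ≤ p := Nat.cast_nonneg _
        linarith
      have e4 : ∑ n ∈ Finset.Ioc 0 M, h p n * h p' n =
          ∑ n ∈ Finset.Ioc (max (A p) (A p')) (min (B p) (B p')), f p n * f p' n := by
        rw [← Finset.sum_subset (s₁ := Finset.Ioc (max (A p) (A p')) (min (B p) (B p')))]
        · refine Finset.sum_congr rfl fun n hn => ?_
          simp only [Finset.mem_Ioc] at hn
          simp only [h]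
          rw [if_pos (by simp only [Finset.mem_Ioc]; omega), if_pos (by simp only [Finset.mem_Ioc]; omega)]
        · refine Finset.Subset.trans ?_ (hsubM p hp)
          intro n hn; simp only [Finset.mem_Ioc] at hn ⊢; omega
        · intro n _ hn
          simp only [h]
          by_cases k1 : n ∈ Finset.Ioc (A p) (B p)
          · by_cases k2 : n ∈ Finset.Ioc (A p') (B p')
            · exfalso; apply hn; simp only [Finset.mem_Ioc] at k1 k2 ⊢; omega
            · rw [if_neg k2, mul_zero]
          · rw [if_neg k1, zero_mul]
      rw [e4]
      by_cases hpp : p = p'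
      · subst hpp
        rw [if_pos rfl, max_self, min_self]
        calc _ ≤ ∑ n ∈ Finset.Ioc (A p) (B p), (1 : ℝ) := by
              refine Finset.sum_le_sum fun n _ => ?_
              have := hf p hp n
              rw [← abs_mul_abs_self]
              nlinarith [abs_nonneg (f p n)]
          _ ≤ B p := by
              rw [Finset.sum_const, Nat.card_Ioc, nsmul_eq_mul, mul_one]
              exact_mod_cast Nat.sub_le _ _
          _ ≤ X / p := hB p hp
          _ ≤ _ := by nlinarith
      · rw [if_neg hpp, zero_add]
        refine (le_abs_self _).trans ?_
        refine (sum_Ioc_bound (p * p') (Nat.mul_pos (hPP p hp).1.pos (hPP p' hp').1.pos)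
          (fun n => f p n * f p' n) ?_ ?_ ?_ _ _).trans ?_
        · intro n; simp
        · rw [sum_prod_range (hPP p hp).1 (hPP p' hp').1 hpp, hf0 p hp, zero_mul]
        · intro n; rw [abs_mul]
          exact mul_le_one₀ (hf p hp n) (abs_nonneg _) (hf p' hp' n)
        · push_cast; rw [sq]
          exact mul_le_mul (hPP p hp).2.2 (hPP p' hp').2.2 (Nat.cast_nonneg _) hPpos
    rw [e2]
    rcases PP.eq_empty_or_nonempty with he | ⟨p0, hp0⟩
    · rw [he]; simp; positivity
    have hPpos : 0 ≤ P := by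
      have := hPP p0 hp0
      have h1 : (0 : ℝ) ≤ p0 := Nat.cast_nonneg _
      linarith
    have hcard : (PP.card : ℝ) ≤ P := by
      have hs : PP ⊆ Finset.Ioc 0 ⌊P⌋₊ := by
        intro p hp
        simp only [Finset.mem_Ioc]
        exact ⟨(hPP p hp).1.pos, Nat.le_floor (hPP p hp).2.2⟩
      have := Finset.card_le_card hs
      rw [Nat.card_Ioc, Nat.sub_zero] at this
      have h2 : (PP.card : ℝ) ≤ ⌊P⌋₊ := by exact_mod_cast this
      exact h2.trans (Nat.floor_le hPpos)
    calc _ ≤ ∑ p ∈ PP, ∑ p' ∈ PP, ((if p = p' then X / p else 0) + P ^ 2) :=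
          Finset.sum_le_sum fun p hp => Finset.sum_le_sum fun p' hp' => e3 p hp p' hp'
      _ = ∑ p ∈ PP, X / p + PP.card * (PP.card * P ^ 2) := by
          simp_rw [Finset.sum_add_distrib]
          congr 1
          · refine Finset.sum_congr rfl fun p hp => ?_
            rw [Finset.sum_ite_eq, if_pos hp]
          · simp
      _ ≤ _ := by
          have : (PP.card : ℝ) * (PP.card * P ^ 2) ≤ P * (P * P ^ 2) := by gcongr
          have e : P * (P * P ^ 2) = P ^ 4 := by ring
          linarith
  exact mul_le_mul c1 c2 (Finset.sum_nonneg fun n _ => sq_nonneg _) (by positivity)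

end CB

namespace CB

/-- primes in a half-open interval -/
def prs (a b : ℕ) : Finset ℕ := (Finset.Ioc a b).filter Nat.Prime

lemma mem_prs {a b n : ℕ} : n ∈ prs a b ↔ (a < n ∧ n ≤ b) ∧ n.Prime := by
  simp [prs]

lemma mertens1 (N : ℕ) (hN : 0 < N) : ∑ p ∈ prs 0 N, log p / p ≤ log N + log 4 := by
  have h1 : ∑ p ∈ prs 0 N, log p * ((N / p : ℕ) : ℝ) ≤ ∑ m ∈ Finset.Ioc 0 N, log m := by
    have e : ∀ p : ℕ, log p * ((N / p : ℕ) : ℝ) = ∑ m ∈ Finset.Ioc 0 N, if p ∣ m then log p else 0 := by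
      intro p
      rw [← Finset.sum_filter, Finset.sum_const, Nat.Ioc_filter_dvd_card_eq_div, nsmul_eq_mul, mul_comm]
    rw [Finset.sum_congr rfl fun p _ => e p, Finset.sum_comm]
    refine Finset.sum_le_sum fun m hm => ?_
    simp only [Finset.mem_Ioc] at hm
    rw [← Finset.sum_filter]
    have hsub : (prs 0 N).filter (fun p => p ∣ m) ⊆ m.primeFactors := by
      intro p hp
      rw [Finset.mem_filter, mem_prs] at hp
      exact Nat.mem_primeFactors.mpr ⟨hp.1.2, hp.2, by omega⟩
    calc _ ≤ ∑ p ∈ m.primeFactors, log p :=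
          Finset.sum_le_sum_of_subset_of_nonneg hsub fun p _ _ => log_natCast_nonneg p
      _ = log (∏ p ∈ m.primeFactors, p : ℕ) := by
          push_cast
          rw [log_prod]
          intro p hp
          exact_mod_cast (Nat.prime_of_mem_primeFactors hp).ne_zero
      _ ≤ log m := by
          have h0 : 0 < ∏ p ∈ m.primeFactors, p :=
            Finset.prod_pos fun p hp => (Nat.prime_of_mem_primeFactors hp).pos
          apply log_le_log (by exact_mod_cast h0)
          exact_mod_cast Nat.le_of_dvd (by omega) (Nat.prod_primeFactors_dvd m)
  have h2 : ∑ m ∈ Finset.Ioc 0 N, log m ≤ N * log N := by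
    calc _ ≤ ∑ m ∈ Finset.Ioc 0 N, log N := by
          refine Finset.sum_le_sum fun m hm => ?_
          simp only [Finset.mem_Ioc] at hm
          apply log_le_log (by exact_mod_cast hm.1)
          exact_mod_cast hm.2
      _ = _ := by simp
  have h3 : ∑ p ∈ prs 0 N, log p ≤ log 4 * N := by
    have := Chebyshev.theta_le_log4_mul_x (x := N) (Nat.cast_nonneg N)
    unfold Chebyshev.theta at this
    rwa [Nat.floor_natCast] at this
  have h4 : N * ∑ p ∈ prs 0 N, log p / p ≤ ∑ p ∈ prs 0 N, (log p * ((N / p : ℕ) : ℝ) + log p) := by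
    rw [Finset.mul_sum]
    refine Finset.sum_le_sum fun p hp => ?_
    have hp0 : (0 : ℝ) < p := by exact_mod_cast (mem_prs.mp hp).2.pos
    have h5 : (N : ℝ) / p ≤ ((N / p : ℕ) : ℝ) + 1 := by
      rw [← Nat.floor_div_eq_div (K := ℝ)]
      exact (Nat.lt_floor_add_one _).le
    have h6 := mul_le_mul_of_nonneg_left h5 (log_natCast_nonneg p)
    calc _ = log p * (N / p) := by ring
      _ ≤ _ := h6
      _ = _ := by ring
  rw [Finset.sum_add_distrib] at h4
  have hN' : (0 : ℝ) < N := by exact_mod_cast hN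
  have h7 : N * ∑ p ∈ prs 0 N, log p / p ≤ N * (log N + log 4) := by linarith
  exact le_of_mul_le_mul_left h7 hN'

lemma recip_block (s t : ℝ) (hs : 1 < s) (ht : 1 ≤ t) :
    ∑ p ∈ prs ⌊s⌋₊ ⌊t⌋₊, (1 : ℝ) / p ≤ (log t + log 4) / log s := by
  have hls : 0 < log s := log_pos hs
  rw [le_div_iff₀ hls, Finset.sum_mul]
  have hsub : prs ⌊s⌋₊ ⌊t⌋₊ ⊆ prs 0 ⌊t⌋₊ := by
    intro p hp; rw [mem_prs] at *; exact ⟨⟨by omega, hp.1.2⟩, hp.2⟩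
  have hfl : 0 < ⌊t⌋₊ := Nat.floor_pos.mpr ht
  calc _ ≤ ∑ p ∈ prs ⌊s⌋₊ ⌊t⌋₊, log p / p := by
        refine Finset.sum_le_sum fun p hp => ?_
        rw [mem_prs] at hp
        have h1 : s < p := (Nat.floor_lt (by linarith)).mp hp.1.1
        have h2 : log s ≤ log p := log_le_log (by linarith) h1.le
        rw [one_div_mul_eq_div]
        gcongr
    _ ≤ ∑ p ∈ prs 0 ⌊t⌋₊, log p / p :=
        Finset.sum_le_sum_of_subset_of_nonneg hsub fun p _ _ =>
          div_nonneg (log_natCast_nonneg p) (Nat.cast_nonneg p)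
    _ ≤ _ := mertens1 _ hfl
    _ ≤ _ := by
        have : log ⌊t⌋₊ ≤ log t := log_le_log (by exact_mod_cast hfl) (Nat.floor_le (by linarith))
        linarith

lemma recip_small (N : ℕ) : ∑ p ∈ prs 0 N, (1 : ℝ) / p ≤ 1 + log N := by
  refine le_trans ?_ (harmonic_le_one_add_log N)
  rw [harmonic_eq_sum_Icc]
  push_cast
  have hsub : prs 0 N ⊆ Finset.Icc 1 N := by
    intro p hp; rw [mem_prs] at hp; simp only [Finset.mem_Icc]; omega
  calc _ ≤ ∑ p ∈ Finset.Icc 1 N, (1 : ℝ) / p :=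
        Finset.sum_le_sum_of_subset_of_nonneg hsub fun p _ _ => by positivity
    _ = _ := by simp

lemma recip_split (a b c : ℕ) (hab : a ≤ b) (hbc : b ≤ c) (f : ℕ → ℝ) :
    ∑ p ∈ prs a c, f p = ∑ p ∈ prs a b, f p + ∑ p ∈ prs b c, f p := by
  have : prs a c = prs a b ∪ prs b c := by
    ext p; simp only [Finset.mem_union, mem_prs]
    constructor
    · rintro ⟨⟨h1, h2⟩, h3⟩
      by_cases h : p ≤ b
      · exact Or.inl ⟨⟨h1, h⟩, h3⟩
      · exact Or.inr ⟨⟨by omega, h2⟩, h3⟩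
    · rintro (⟨⟨h1, h2⟩, h3⟩ | ⟨⟨h1, h2⟩, h3⟩)
      · exact ⟨⟨h1, by omega⟩, h3⟩
      · exact ⟨⟨by omega, h2⟩, h3⟩
  rw [this, Finset.sum_union]
  rw [Finset.disjoint_left]
  intro p h1 h2
  rw [mem_prs] at h1 h2
  omega

/-- the multiplicative function `1/n` -/
noncomputable def invHom : ℕ →* ℝ where
  toFun n := (1 : ℝ) / n
  map_one' := by simp
  map_mul' a b := by push_cast; rw [one_div_mul_one_div]

lemma recip_lower (N : ℕ) (hN : 2 ≤ N) : log (log N) - 1 ≤ ∑ p ∈ prs 0 N, (1 : ℝ) / p := by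
  have hs := EulerProduct.summable_and_hasSum_smoothNumbers_prod_primesBelow_geometric
    (f := invHom) (fun {p} hp => by
      have : (1 : ℝ) < p := by exact_mod_cast hp.one_lt
      simp only [invHom, MonoidHom.coe_mk, OneHom.coe_mk, norm_eq_abs]
      rw [abs_of_pos (by positivity), div_lt_one (by linarith)]
      exact this) (N + 1)
  obtain ⟨-, hs⟩ := hs
  have h1 : (harmonic N : ℝ) ≤ ∏ p ∈ (N + 1).primesBelow, (1 - invHom p)⁻¹ := by
    rw [harmonic_eq_sum_Icc]
    push_cast
    rw [← hs.tsum_eq]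
    have hmem : ∀ n ∈ Finset.Icc 1 N, n ∈ Nat.smoothNumbers (N + 1) := by
      intro n hn
      simp only [Finset.mem_Icc] at hn
      exact Nat.mem_smoothNumbers_of_lt (by omega) (by omega)
    rw [← Finset.sum_attach]
    have e : ∑ x ∈ (Finset.Icc 1 N).attach, ((x.1 : ℝ))⁻¹ =
        ∑ m ∈ ((Finset.Icc 1 N).attach.image (fun x => (⟨x.1, hmem x.1 x.2⟩ : Nat.smoothNumbers (N + 1)))),
          invHom m := by
      rw [Finset.sum_image]
      · simp [invHom]
      · intro a _ b _ hab
        exact Subtype.ext (congrArg (fun z : Nat.smoothNumbers (N + 1) => z.1) hab)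
    rw [e]
    refine hs.summable.sum_le_tsum _ (fun m _ => ?_)
    simp only [invHom, MonoidHom.coe_mk, OneHom.coe_mk]
    positivity
  have h2 : log N ≤ ∏ p ∈ (N + 1).primesBelow, (1 - invHom p)⁻¹ := by
    refine le_trans ?_ h1
    refine le_trans ?_ (log_add_one_le_harmonic N)
    apply log_le_log (by positivity)
    push_cast
    linarith
  have hlog : 0 < log (N : ℝ) := log_pos (by exact_mod_cast hN)
  have h3 := log_le_log hlog h2
  have hprs : (N + 1).primesBelow = prs 0 N := by
    ext p
    simp only [Nat.mem_primesBelow, mem_prs]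
    constructor
    · rintro ⟨a, b⟩; exact ⟨⟨b.pos, by omega⟩, b⟩
    · rintro ⟨a, b⟩; exact ⟨by omega, b⟩
  rw [hprs] at h3
  have hpos : ∀ p ∈ prs 0 N, (1 - invHom p)⁻¹ = p / (p - 1) := by
    intro p hp
    have : (1 : ℝ) < p := by exact_mod_cast (mem_prs.mp hp).2.one_lt
    simp only [invHom, MonoidHom.coe_mk, OneHom.coe_mk]
    have : (p : ℝ) - 1 ≠ 0 := by linarith
    field_simp
  have hp2 : ∀ p ∈ prs 0 N, (2 : ℝ) ≤ p := fun p hp => by exact_mod_cast (mem_prs.mp hp).2.two_le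
  rw [Finset.prod_congr rfl hpos, log_prod (fun p hp => by
    have := hp2 p hp
    exact (div_pos (by linarith) (by linarith)).ne')] at h3
  have h4 : ∑ p ∈ prs 0 N, log ((p : ℝ) / (p - 1)) ≤
      ∑ p ∈ prs 0 N, ((1 : ℝ) / p + (1 / ((p : ℝ) - 1) - 1 / p)) := by
    refine Finset.sum_le_sum fun p hp => ?_
    have := hp2 p hp
    have h5 := log_le_sub_one_of_pos (x := (p : ℝ) / (p - 1)) (div_pos (by linarith) (by linarith))
    have h6 : (p : ℝ) / (p - 1) - 1 = 1 / (p - 1) := by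
      have : (p : ℝ) - 1 ≠ 0 := by linarith
      field_simp; ring
    linarith
  rw [Finset.sum_add_distrib] at h4
  have h7 : ∑ p ∈ prs 0 N, (1 / ((p : ℝ) - 1) - 1 / p) ≤ 1 := by
    have hsub : prs 0 N ⊆ Finset.Ico 2 (N + 1) := by
      intro p hp
      have := (mem_prs.mp hp).2.two_le
      rw [mem_prs] at hp
      simp only [Finset.mem_Ico]; omega
    calc _ ≤ ∑ p ∈ Finset.Ico 2 (N + 1), (1 / ((p : ℝ) - 1) - 1 / p) := by
          refine Finset.sum_le_sum_of_subset_of_nonneg hsub fun p hp _ => ?_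
          simp only [Finset.mem_Ico] at hp
          have : (2 : ℝ) ≤ p := by exact_mod_cast hp.1
          have := one_div_le_one_div_of_le (show (0 : ℝ) < p - 1 by linarith) (show (p : ℝ) - 1 ≤ p by linarith)
          linarith
      _ = 1 - 1 / N := by
          clear * - hN
          induction N, hN using Nat.le_induction with
          | base => norm_num
          | succ n hn ih =>
            rw [Finset.sum_Ico_succ_top (by omega), ih]
            push_cast
            ring
      _ ≤ 1 := by
          have : (0 : ℝ) ≤ 1 / N := by positivity
          linarith
  linarith

end CB

namespace CB

lemma dispersion2 (PP : Finset ℕ) (P0 X H : ℝ) (hP0 : 0 < P0) (hX : 0 ≤ X)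
    (hPP : ∀ p ∈ PP, p.Prime ∧ P0 ≤ p ∧ (p : ℝ) ^ 4 ≤ X) (hH : ∑ p ∈ PP, (1 : ℝ) / p ≤ H)
    (hX1 : 1 ≤ X) (f : ∀ p : ℕ, ZMod p → ℝ)
    (hf : ∀ p ∈ PP, ∀ s, |f p s| ≤ 1) (hf0 : ∀ p ∈ PP, ∑ n ∈ Finset.range p, f p n = 0)
    (A B : ℕ → ℕ) (hB : ∀ p ∈ PP, (B p : ℝ) ≤ X / p) (S : ℕ → Prop) [DecidablePred S] :
    |∑ p ∈ PP, ∑ n ∈ (Finset.Ioc (A p) (B p)).filter S, f p n| ≤ X * √((H + 1) / P0) := by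
  have e4 : (X ^ (1 / 4 : ℝ)) ^ 4 = X := by
    rw [← rpow_natCast, ← rpow_mul hX]; norm_num
  have h1 := dispersion PP P0 (X ^ (1 / 4 : ℝ)) X hP0 hX (fun p hp => ⟨(hPP p hp).1, (hPP p hp).2.1, by
    refine le_of_pow_le_pow_left₀ (n := 4) (by norm_num) (by positivity) ?_
    rw [e4]; exact (hPP p hp).2.2⟩) f hf hf0 A B hB S
  rw [e4] at h1
  have hH0 : 0 ≤ H := le_trans (Finset.sum_nonneg fun p _ => by positivity) hH
  have h2 : X / P0 * (∑ p ∈ PP, X / p + X) ≤ (X * √((H + 1) / P0)) ^ 2 := by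
    rw [mul_pow, sq_sqrt (by positivity)]
    have : ∑ p ∈ PP, X / p = X * ∑ p ∈ PP, (1 : ℝ) / p := by
      rw [Finset.mul_sum]; refine Finset.sum_congr rfl fun p _ => by ring
    rw [this]
    calc _ ≤ X / P0 * (X * H + X) := by gcongr
      _ = _ := by ring
  exact abs_le_of_sq_le_sq (h1.trans h2) (by positivity)

/-- the triples -/
def TT (N Q K : ℕ) : Finset (ℕ × ℕ × ℕ) :=
  (prs K Q ×ˢ prs 0 Q ×ˢ prs 0 N).filter
    (fun t => t.1 ^ 10 < t.2.1 ∧ t.2.1 < t.2.2 ∧ t.1 * t.2.1 * t.2.2 ≤ N)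

/-- mean over the last variable -/
noncomputable def mm (p : ℕ) (s : ZMod p) : ℝ := (1 / p) * ∑ n ∈ Finset.range p, bd p s n
/-- total mean -/
noncomputable def mu (p : ℕ) : ℝ := (1 / p) * ∑ n ∈ Finset.range p, mm p n

lemma mm_nonneg (p : ℕ) (s : ZMod p) : 0 ≤ mm p s := by
  unfold mm
  have : 0 ≤ ∑ n ∈ Finset.range p, bd p s n := Finset.sum_nonneg fun n _ => bd_nonneg _ _ _
  positivity

lemma mm_le_one (p : ℕ) (hp : 0 < p) (s : ZMod p) : mm p s ≤ 1 := by
  unfold mm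
  have : ∑ n ∈ Finset.range p, bd p s n ≤ ∑ n ∈ Finset.range p, (1 : ℝ) :=
    Finset.sum_le_sum fun n _ => bd_le_one _ _ _
  have hp' : (0 : ℝ) < p := by exact_mod_cast hp
  rw [one_div_mul_eq_div, div_le_one hp']
  simpa using this

lemma mu_nonneg (p : ℕ) : 0 ≤ mu p := by
  unfold mu
  have : 0 ≤ ∑ n ∈ Finset.range p, mm p n := Finset.sum_nonneg fun n _ => mm_nonneg _ _
  positivity

lemma mu_le_one (p : ℕ) (hp : 0 < p) : mu p ≤ 1 := by
  unfold mu
  have : ∑ n ∈ Finset.range p, mm p n ≤ ∑ n ∈ Finset.range p, (1 : ℝ) :=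
    Finset.sum_le_sum fun n _ => mm_le_one _ hp _
  have hp' : (0 : ℝ) < p := by exact_mod_cast hp
  rw [one_div_mul_eq_div, div_le_one hp']
  simpa using this

lemma mu_le (p : ℕ) (hp : p.Prime) : mu p ≤ 2 / 27 + 20 / p := by
  have := Fact.mk hp
  have hp' : (0 : ℝ) < p := by exact_mod_cast hp.pos
  have h := bd_sum p hp
  have e : mu p = (∑ s : ZMod p, ∑ t : ZMod p, bd p s t) / p ^ 2 := by
    unfold mu
    rw [sum_range_zmod p (fun s => mm p s)]
    unfold mm
    rw [← Finset.mul_sum, Finset.sum_congr rfl fun s _ => sum_range_zmod p (fun t => bd p s t)]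
    field_simp
  rw [e, div_le_iff₀ (by positivity)]
  refine h.trans (le_of_eq ?_)
  field_simp

lemma err1 (N Q K : ℕ) (hK : 0 < K) (hQ : Q ^ 10 ≤ N) (H : ℝ)
    (hH : ∀ M ≤ N, ∑ p ∈ prs 0 M, (1 : ℝ) / p ≤ H) :
    |∑ t ∈ TT N Q K, (bd t.1 t.2.1 t.2.2 - mm t.1 t.2.1)| ≤ N * H * √((H + 1) / K) := by
  classical
  have hQN : Q ≤ N := le_trans (Nat.le_self_pow (by norm_num) Q) hQ
  unfold TT
  rw [Finset.sum_filter, Finset.sum_product]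
  simp_rw [Finset.sum_product]
  rw [Finset.sum_comm]
  refine (Finset.abs_sum_le_sum_abs _ _).trans ?_
  have key : ∀ q ∈ prs 0 Q, |∑ p ∈ prs K Q, ∑ r ∈ prs 0 N, (if p ^ 10 < q ∧ q < r ∧ p * q * r ≤ N then
      bd p q r - mm p q else 0)| ≤ (N / q : ℝ) * √((H + 1) / K) := by
    intro q hq
    have hq' := mem_prs.mp hq
    have hq0 : (0 : ℝ) < q := by exact_mod_cast hq'.1.1
    have hqN : q * q ≤ N := by
      calc q * q ≤ Q * Q := Nat.mul_le_mul hq'.1.2 hq'.1.2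
        _ = Q ^ 2 := by ring
        _ ≤ Q ^ 10 := Nat.pow_le_pow_right (by omega) (by norm_num)
        _ ≤ N := hQ
    have hqN' : (q : ℝ) ≤ N / q := by
      rw [le_div_iff₀ hq0]; exact_mod_cast hqN
    have e : ∑ p ∈ prs K Q, ∑ r ∈ prs 0 N, (if p ^ 10 < q ∧ q < r ∧ p * q * r ≤ N then
      bd p q r - mm p q else 0) = ∑ p ∈ (prs K Q).filter (fun p => p ^ 10 < q),
        ∑ r ∈ (Finset.Ioc q (N / (p * q))).filter Nat.Prime, (fun (p : ℕ) (s : ZMod p) => bd p q s - mm p q) p r := by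
      rw [Finset.sum_filter]
      refine Finset.sum_congr rfl fun p hp => ?_
      have hp' := mem_prs.mp hp
      split_ifs with h10
      · simp only [h10, true_and]
        rw [← Finset.sum_filter]
        refine Finset.sum_congr ?_ fun _ _ => rfl
        ext r
        have hpq : 0 < p * q := Nat.mul_pos hp'.2.pos hq'.2.pos
        simp only [Finset.mem_filter, mem_prs, Finset.mem_Ioc, Nat.le_div_iff_mul_le hpq, mul_comm r]
        constructor
        · rintro ⟨⟨⟨a, b⟩, c⟩, d, e⟩; exact ⟨⟨d, e⟩, c⟩
        · rintro ⟨⟨a, b⟩, c⟩; exact ⟨⟨⟨by omega, le_trans (Nat.le_mul_of_pos_left r hpq) b⟩, c⟩, a, b⟩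
      · apply Finset.sum_eq_zero; intro r _; rw [if_neg]; tauto
    rw [e]
    refine dispersion2 _ (K : ℝ) (N / q) H (by exact_mod_cast hK) (by positivity) ?_ ?_ ?_ (fun (p : ℕ) (s : ZMod p) => bd p q s - mm p q) ?_ ?_ (fun _ => q) (fun p => N / (p * q)) ?_ Nat.Prime
    · intro p hp
      rw [Finset.mem_filter, mem_prs] at hp
      refine ⟨hp.1.2, by exact_mod_cast hp.1.1.1.le, le_trans ?_ hqN'⟩
      have : p ^ 4 ≤ p ^ 10 := Nat.pow_le_pow_right hp.1.2.pos (by norm_num)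
      exact_mod_cast this.trans hp.2.le
    · refine le_trans ?_ (hH Q hQN)
      refine Finset.sum_le_sum_of_subset_of_nonneg ?_ fun p _ _ => by positivity
      intro p hp
      rw [Finset.mem_filter, mem_prs] at hp
      rw [mem_prs]; exact ⟨⟨by omega, hp.1.1.2⟩, hp.1.2⟩
    · refine le_trans ?_ hqN'
      exact_mod_cast hq'.1.1
    · intro p hp s
      rw [Finset.mem_filter, mem_prs] at hp
      have h1 := bd_nonneg p q s
      have h2 := bd_le_one p q s
      have h3 := mm_nonneg p q
      have h4 := mm_le_one p hp.1.2.pos q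
      rw [abs_le]; constructor <;> linarith
    · intro p hp
      rw [Finset.mem_filter, mem_prs] at hp
      have : (p : ℝ) ≠ 0 := by exact_mod_cast hp.1.2.ne_zero
      rw [Finset.sum_sub_distrib, Finset.sum_const, Finset.card_range, nsmul_eq_mul]
      unfold mm
      field_simp
      ring
    · intro p hp
      refine (Nat.cast_div_le).trans (le_of_eq ?_)
      push_cast
      rw [div_div, mul_comm]
  refine (Finset.sum_le_sum key).trans ?_
  rw [← Finset.sum_mul]
  have hs : ∑ q ∈ prs 0 Q, (N / q : ℝ) ≤ N * H := by
    have : ∑ q ∈ prs 0 Q, (N / q : ℝ) = N * ∑ q ∈ prs 0 Q, (1 : ℝ) / q := by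
      rw [Finset.mul_sum]; refine Finset.sum_congr rfl fun p _ => by ring
    rw [this]
    exact mul_le_mul_of_nonneg_left (hH Q hQN) (Nat.cast_nonneg _)
  exact mul_le_mul_of_nonneg_right hs (sqrt_nonneg _)

lemma err2 (N Q K : ℕ) (hK : 0 < K) (hQ : Q ^ 10 ≤ N) (H : ℝ)
    (hH : ∀ M ≤ N, ∑ p ∈ prs 0 M, (1 : ℝ) / p ≤ H) :
    |∑ t ∈ TT N Q K, (mm t.1 t.2.1 - mu t.1)| ≤ N * H * √((H + 1) / K) := by
  classical
  have hQN : Q ≤ N := le_trans (Nat.le_self_pow (by norm_num) Q) hQ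
  unfold TT
  rw [Finset.sum_filter, Finset.sum_product]
  simp_rw [Finset.sum_product]
  rw [Finset.sum_congr rfl fun p _ => Finset.sum_comm, Finset.sum_comm]
  refine (Finset.abs_sum_le_sum_abs _ _).trans ?_
  have key : ∀ r ∈ prs 0 N, |∑ p ∈ prs K Q, ∑ q ∈ prs 0 Q, (if p ^ 10 < q ∧ q < r ∧ p * q * r ≤ N then
      mm p q - mu p else 0)| ≤ (N / r : ℝ) * √((H + 1) / K) := by
    intro r hr
    have hr' := mem_prs.mp hr
    have hr0 : (0 : ℝ) < r := by exact_mod_cast hr'.1.1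
    have e : ∑ p ∈ prs K Q, ∑ q ∈ prs 0 Q, (if p ^ 10 < q ∧ q < r ∧ p * q * r ≤ N then
      mm p q - mu p else 0) = ∑ p ∈ (prs K Q).filter (fun p => p ^ 10 * r ≤ N),
        ∑ q ∈ (Finset.Ioc (p ^ 10) (min (min Q (r - 1)) (N / (p * r)))).filter Nat.Prime,
          (fun (p : ℕ) (s : ZMod p) => mm p s - mu p) p q := by
      rw [Finset.sum_filter]
      refine Finset.sum_congr rfl fun p hp => ?_
      have hp' := mem_prs.mp hp
      split_ifs with h10
      · rw [← Finset.sum_filter]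
        refine Finset.sum_congr ?_ fun _ _ => rfl
        ext q
        have hpq : 0 < p * r := Nat.mul_pos hp'.2.pos hr'.2.pos
        simp only [Finset.mem_filter, mem_prs, Finset.mem_Ioc, le_min_iff, Nat.le_div_iff_mul_le hpq,
          show q * (p * r) = p * q * r by ring]
        constructor
        · rintro ⟨⟨⟨a, b⟩, c⟩, d, e, f⟩; exact ⟨⟨d, ⟨b, by omega⟩, f⟩, c⟩
        · rintro ⟨⟨a, ⟨b, b'⟩, d⟩, c⟩; exact ⟨⟨⟨c.pos, b⟩, c⟩, a, by omega, d⟩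
      · apply Finset.sum_eq_zero; intro q hq; rw [if_neg]
        rintro ⟨h1, h2, h3⟩
        apply h10
        calc p ^ 10 * r ≤ q * r := Nat.mul_le_mul_right _ h1.le
          _ ≤ p * (q * r) := Nat.le_mul_of_pos_left _ hp'.2.pos
          _ = p * q * r := by ring
          _ ≤ N := h3
    rw [e]
    refine dispersion2 _ (K : ℝ) (N / r) H (by exact_mod_cast hK) (by positivity) ?_ ?_ ?_ (fun (p : ℕ) (s : ZMod p) => mm p s - mu p) ?_ ?_ (fun p => p ^ 10) (fun p => min (min Q (r - 1)) (N / (p * r))) ?_ Nat.Prime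
    · intro p hp
      rw [Finset.mem_filter, mem_prs] at hp
      refine ⟨hp.1.2, by exact_mod_cast hp.1.1.1.le, ?_⟩
      have : p ^ 4 ≤ p ^ 10 := Nat.pow_le_pow_right hp.1.2.pos (by norm_num)
      rw [le_div_iff₀ hr0]
      exact_mod_cast (Nat.mul_le_mul_right r this).trans hp.2
    · refine le_trans ?_ (hH Q hQN)
      refine Finset.sum_le_sum_of_subset_of_nonneg ?_ fun p _ _ => by positivity
      intro p hp
      rw [Finset.mem_filter, mem_prs] at hp
      rw [mem_prs]; exact ⟨⟨by omega, hp.1.1.2⟩, hp.1.2⟩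
    · rw [le_div_iff₀ hr0, one_mul]
      exact_mod_cast hr'.1.2
    · intro p hp s
      rw [Finset.mem_filter, mem_prs] at hp
      have h1 := mm_nonneg p s
      have h2 := mm_le_one p hp.1.2.pos s
      have h3 := mu_nonneg p
      have h4 := mu_le_one p hp.1.2.pos
      rw [abs_le]; constructor <;> linarith
    · intro p hp
      rw [Finset.mem_filter, mem_prs] at hp
      have : (p : ℝ) ≠ 0 := by exact_mod_cast hp.1.2.ne_zero
      rw [Finset.sum_sub_distrib, Finset.sum_const, Finset.card_range, nsmul_eq_mul]
      unfold mu
      field_simp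
      ring
    · intro p hp
      calc ((min (min Q (r - 1)) (N / (p * r)) : ℕ) : ℝ) ≤ ((N / (p * r) : ℕ) : ℝ) := by
            exact_mod_cast min_le_right _ _
        _ ≤ _ := Nat.cast_div_le
        _ = _ := by push_cast; rw [div_div, mul_comm]
  refine (Finset.sum_le_sum key).trans ?_
  rw [← Finset.sum_mul]
  have hs : ∑ q ∈ prs 0 N, (N / q : ℝ) ≤ N * H := by
    have : ∑ q ∈ prs 0 N, (N / q : ℝ) = N * ∑ q ∈ prs 0 N, (1 : ℝ) / q := by
      rw [Finset.mul_sum]; refine Finset.sum_congr rfl fun p _ => by ring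
    rw [this]
    exact mul_le_mul_of_nonneg_left (hH N le_rfl) (Nat.cast_nonneg _)
  exact mul_le_mul_of_nonneg_right hs (sqrt_nonneg _)

lemma bad_total (N Q K : ℕ) (hK : 0 < K) (hQ : Q ^ 10 ≤ N) (H : ℝ)
    (hH : ∀ M ≤ N, ∑ p ∈ prs 0 M, (1 : ℝ) / p ≤ H) :
    ∑ t ∈ TT N Q K, bd t.1 t.2.1 t.2.2 ≤
      (2 / 27 + 20 / K) * (TT N Q K).card + 2 * (N * H * √((H + 1) / K)) := by
  have h1 := (abs_le.mp (err1 N Q K hK hQ H hH)).2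
  have h2 := (abs_le.mp (err2 N Q K hK hQ H hH)).2
  have h3 : ∑ t ∈ TT N Q K, mu t.1 ≤ ∑ t ∈ TT N Q K, (2 / 27 + 20 / K : ℝ) := by
    refine Finset.sum_le_sum fun t ht => ?_
    simp only [TT, Finset.mem_filter, Finset.mem_product, mem_prs] at ht
    refine (mu_le t.1 ht.1.1.2).trans ?_
    have hK' : (0 : ℝ) < K := by exact_mod_cast hK
    have : (K : ℝ) ≤ t.1 := by exact_mod_cast ht.1.1.1.1.le
    gcongr
  rw [Finset.sum_const, nsmul_eq_mul, mul_comm] at h3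
  rw [Finset.sum_sub_distrib] at h1 h2
  linarith

end CB

namespace CB

/-- weight sum -/
noncomputable def WW (K Q : ℕ) : ℝ := ∑ p ∈ prs K Q, ∑ q ∈ prs (p ^ 10) Q, (1 : ℝ) / (p * q)

lemma W_lower (K Q : ℕ) (hK : 2 ≤ K) (D : ℝ) (hD : D = ∑ p ∈ prs K Q, (1 : ℝ) / p) :
    D ^ 2 - 25 * D ≤ 2 * WW K Q := by
  have hp12 : ∀ p ∈ prs K Q, ∑ q ∈ prs p (p ^ 10), (1 : ℝ) / q ≤ 12 := by
    intro p hp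
    have hp' := mem_prs.mp hp
    have hp2 : (2 : ℝ) ≤ p := by exact_mod_cast hp'.2.two_le
    have h := recip_block (p : ℝ) ((p : ℝ) ^ 10) (by linarith) (one_le_pow₀ (by linarith))
    have e : ⌊(p : ℝ) ^ 10⌋₊ = p ^ 10 := by
      rw [← Nat.cast_pow, Nat.floor_natCast]
    rw [e, Nat.floor_natCast] at h
    refine h.trans ?_
    have hl : log 2 ≤ log p := log_le_log (by norm_num) hp2
    have h2 : 0 < log 2 := log_pos (by norm_num)
    have h4 : log 4 = 2 * log 2 := by
      rw [show (4 : ℝ) = 2 ^ 2 by norm_num, log_pow]; push_cast; ring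
    rw [div_le_iff₀ (by linarith), log_pow, h4]
    push_cast
    linarith
  have h1 : D ^ 2 = ∑ p ∈ prs K Q, ∑ q ∈ prs K Q, (1 : ℝ) / (p * q) := by
    rw [sq, hD, Finset.sum_mul_sum]
    refine Finset.sum_congr rfl fun p _ => Finset.sum_congr rfl fun q _ => ?_
    rw [one_div_mul_one_div]
  have h2 : ∑ p ∈ prs K Q, ∑ q ∈ prs K Q, (1 : ℝ) / (p * q) =
      ∑ p ∈ prs K Q, ∑ q ∈ prs K Q, (if p < q then (1 : ℝ) / (p * q) else 0) +
      ∑ p ∈ prs K Q, ∑ q ∈ prs K Q, (if q < p then (1 : ℝ) / (p * q) else 0) +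
      ∑ p ∈ prs K Q, ∑ q ∈ prs K Q, (if p = q then (1 : ℝ) / (p * q) else 0) := by
    simp_rw [← Finset.sum_add_distrib]
    refine Finset.sum_congr rfl fun p _ => Finset.sum_congr rfl fun q _ => ?_
    rcases lt_trichotomy p q with h | h | h
    · simp [h, h.ne, h.not_gt]
    · simp [h]
    · simp [h, h.ne', h.not_gt]
  have h3 : ∑ p ∈ prs K Q, ∑ q ∈ prs K Q, (if q < p then (1 : ℝ) / (p * q) else 0) =
      ∑ p ∈ prs K Q, ∑ q ∈ prs K Q, (if p < q then (1 : ℝ) / (p * q) else 0) := by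
    rw [Finset.sum_comm]
    refine Finset.sum_congr rfl fun p _ => Finset.sum_congr rfl fun q _ => ?_
    rw [mul_comm]
  have h4 : ∑ p ∈ prs K Q, ∑ q ∈ prs K Q, (if p = q then (1 : ℝ) / (p * q) else 0) ≤ D := by
    rw [hD]
    refine Finset.sum_le_sum fun p hp => ?_
    rw [Finset.sum_ite_eq, if_pos hp]
    have hp' := mem_prs.mp hp
    have hp2 : (1 : ℝ) ≤ p := by exact_mod_cast hp'.2.one_le
    refine one_div_le_one_div_of_le (by linarith) (by nlinarith)
  have h5 : ∑ p ∈ prs K Q, ∑ q ∈ prs K Q, (if p < q then (1 : ℝ) / (p * q) else 0) ≤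
      WW K Q + 12 * D := by
    unfold WW
    rw [hD, Finset.mul_sum, ← Finset.sum_add_distrib]
    refine Finset.sum_le_sum fun p hp => ?_
    have hp' := mem_prs.mp hp
    have hp2 : (0 : ℝ) < p := by exact_mod_cast hp'.2.pos
    have a1 := mul_le_mul_of_nonneg_left (hp12 p hp) (by positivity : 0 ≤ (1 : ℝ) / p)
    have a2 : (1 : ℝ) / p * ∑ q ∈ prs p (p ^ 10), (1 : ℝ) / q =
        ∑ q ∈ prs p (p ^ 10), (1 : ℝ) / (p * q) := by
      rw [Finset.mul_sum]
      exact Finset.sum_congr rfl fun q _ => by rw [one_div_mul_one_div]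
    have a3 : ∑ q ∈ prs K Q, (if p < q then (1 : ℝ) / (p * q) else 0) ≤
        ∑ q ∈ prs (p ^ 10) Q ∪ prs p (p ^ 10), (1 : ℝ) / (p * q) := by
      rw [← Finset.sum_filter]
      refine Finset.sum_le_sum_of_subset_of_nonneg ?_ fun _ _ _ => by positivity
      intro q hq
      rw [Finset.mem_filter, mem_prs] at hq
      rw [Finset.mem_union, mem_prs, mem_prs]
      rcases le_or_gt q (p ^ 10) with h | h
      · exact Or.inr ⟨⟨hq.2, h⟩, hq.1.2⟩
      · exact Or.inl ⟨⟨h, hq.1.1.2⟩, hq.1.2⟩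
    have a4 : ∑ q ∈ prs (p ^ 10) Q ∪ prs p (p ^ 10), (1 : ℝ) / (p * q) =
        ∑ q ∈ prs (p ^ 10) Q, (1 : ℝ) / (p * q) + ∑ q ∈ prs p (p ^ 10), (1 : ℝ) / (p * q) := by
      apply Finset.sum_union
      rw [Finset.disjoint_left]
      intro q h1 h2
      rw [mem_prs] at h1 h2
      omega
    linarith
  rw [h1, h2, h3]
  linarith

lemma prs_card (a b : ℕ) : (Nat.primeCounting b : ℝ) - a ≤ (prs a b).card := by
  have e : Nat.primeCounting b = (prs 0 b).card := by
    rw [Nat.primeCounting, Nat.primeCounting', Nat.count_eq_card_filter_range]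
    congr 1
    ext n
    rw [Finset.mem_filter, Finset.mem_range, mem_prs]
    constructor
    · rintro ⟨h1, h2⟩; exact ⟨⟨h2.pos, by omega⟩, h2⟩
    · rintro ⟨h1, h2⟩; exact ⟨by omega, h2⟩
  have h : (prs 0 b).card ≤ (Finset.Ioc 0 a).card + (prs a b).card := by
    refine (Finset.card_le_card ?_).trans (Finset.card_union_le _ _)
    intro n hn
    rw [mem_prs] at hn
    rw [Finset.mem_union, mem_prs, Finset.mem_Ioc]
    rcases le_or_gt n a with h | h
    · exact Or.inl ⟨hn.1.1, h⟩
    · exact Or.inr ⟨⟨h, hn.1.2⟩, hn.2⟩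
  rw [e]
  rw [Nat.card_Ioc, Nat.sub_zero] at h
  have : ((prs 0 b).card : ℝ) ≤ a + (prs a b).card := by exact_mod_cast h
  linarith

lemma TT_lower (N Q K : ℕ) (hN : 2 ≤ N) (δ y0 : ℝ) (hQ : 0 < Q) (hy : y0 ≤ N / (Q : ℝ) ^ 2)
    (hπ : ∀ y ≥ y0, (1 - δ) * y ≤ (Nat.primeCounting ⌊y⌋₊ : ℝ) * log y) :
    (1 - δ) * (N / log N) * WW K Q - (Q : ℝ) ^ 3 ≤ (TT N Q K).card := by
  have hQ0 : (0 : ℝ) < Q := by exact_mod_cast hQ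
  have hN0 : (0 : ℝ) < N := by exact_mod_cast (by omega : 0 < N)
  have hlog : 0 < log N := log_pos (by exact_mod_cast (by omega : 1 < N))
  have e : ((TT N Q K).card : ℝ) ≥ ∑ p ∈ prs K Q, ∑ q ∈ prs (p ^ 10) Q,
      ((prs q (N / (p * q))).card : ℝ) := by
    have : (TT N Q K).card = ∑ p ∈ prs K Q, ∑ q ∈ prs 0 Q, ∑ r ∈ prs 0 N,
        (if p ^ 10 < q ∧ q < r ∧ p * q * r ≤ N then 1 else 0) := by
      unfold TT
      rw [Finset.card_filter, Finset.sum_product]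
      simp_rw [Finset.sum_product]
    rw [this]
    push_cast
    refine Finset.sum_le_sum fun p hp => ?_
    have hp' := mem_prs.mp hp
    have hs : prs (p ^ 10) Q ⊆ prs 0 Q := by
      intro q hq; rw [mem_prs] at hq ⊢; exact ⟨⟨by omega, hq.1.2⟩, hq.2⟩
    refine le_trans ?_ (Finset.sum_le_sum_of_subset_of_nonneg hs fun _ _ _ =>
      Finset.sum_nonneg fun _ _ => by split_ifs <;> norm_num)
    refine Finset.sum_le_sum fun q hq => ?_
    have hq' := mem_prs.mp hq
    rw [← Finset.sum_filter, Finset.sum_const, nsmul_eq_mul, mul_one, Nat.cast_le]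
    apply Finset.card_le_card
    intro r hr
    rw [mem_prs] at hr
    have hpq : 0 < p * q := Nat.mul_pos hp'.2.pos hq'.2.pos
    rw [Nat.le_div_iff_mul_le hpq, mul_comm] at hr
    rw [Finset.mem_filter, mem_prs]
    exact ⟨⟨⟨hr.2.pos, le_trans (Nat.le_mul_of_pos_left r hpq) hr.1.2⟩, hr.2⟩, hq'.1.1, hr.1.1, hr.1.2⟩
  have key : ∀ p ∈ prs K Q, ∀ q ∈ prs (p ^ 10) Q,
      (1 - δ) * (N / log N) * (1 / (p * q)) - Q ≤ ((prs q (N / (p * q))).card : ℝ) := by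
    intro p hp q hq
    have hp' := mem_prs.mp hp
    have hq' := mem_prs.mp hq
    have hp0 : (1 : ℝ) ≤ p := by exact_mod_cast hp'.2.one_le
    have hq0 : (1 : ℝ) ≤ q := by exact_mod_cast hq'.2.one_le
    have hpQ : (p : ℝ) ≤ Q := by exact_mod_cast hp'.1.2
    have hqQ : (q : ℝ) ≤ Q := by exact_mod_cast hq'.1.2
    have h1 := prs_card q (N / (p * q))
    have hfl : ⌊(N : ℝ) / (p * q)⌋₊ = N / (p * q) := by
      rw [← Nat.cast_mul, Nat.floor_div_natCast, Nat.floor_natCast]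
    have hpq0 : (1 : ℝ) ≤ p * q := by nlinarith
    have h2 := hπ ((N : ℝ) / (p * q)) (le_trans hy (by
      apply div_le_div_of_nonneg_left hN0.le (by linarith)
      rw [sq]; gcongr))
    rw [hfl] at h2
    have h3 : log ((N : ℝ) / (p * q)) ≤ log N := by
      apply log_le_log (by positivity)
      exact div_le_self hN0.le hpq0
    have h4 := h2.trans (mul_le_mul_of_nonneg_left h3 (Nat.cast_nonneg _))
    have h5 : (1 - δ) * (N / log N) * (1 / (p * q)) ≤ (Nat.primeCounting (N / (p * q)) : ℝ) := by
      rw [← div_le_iff₀ hlog] at h4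
      refine le_trans (le_of_eq ?_) h4
      field_simp
    linarith
  refine le_trans ?_ e
  refine le_trans ?_ (Finset.sum_le_sum fun p hp => Finset.sum_le_sum fun q hq => key p hp q hq)
  have hc : ∀ a, ((prs a Q).card : ℝ) ≤ Q := by
    intro a
    have := Finset.card_filter_le (Finset.Ioc a Q) Nat.Prime
    rw [Nat.card_Ioc] at this
    have h : (prs a Q).card ≤ Q := by unfold prs; omega
    exact_mod_cast h
  simp_rw [Finset.sum_sub_distrib, ← Finset.mul_sum]
  have h6 : ∑ p ∈ prs K Q, ∑ q ∈ prs (p ^ 10) Q, (Q : ℝ) ≤ (Q : ℝ) ^ 3 := by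
    calc _ ≤ ∑ p ∈ prs K Q, ((Q : ℝ) * Q) := by
          refine Finset.sum_le_sum fun p _ => ?_
          rw [Finset.sum_const, nsmul_eq_mul]
          exact mul_le_mul_of_nonneg_right (hc _) hQ0.le
      _ ≤ Q * (Q * Q) := by
          rw [Finset.sum_const, nsmul_eq_mul]
          exact mul_le_mul_of_nonneg_right (hc _) (by positivity)
      _ = _ := by ring
  unfold WW
  linarith

end CB

namespace CB

lemma triple_inj {p q r p' q' r' : ℕ} (hp : p.Prime) (hq : q.Prime) (hr : r.Prime)
    (hp' : p'.Prime) (hq' : q'.Prime) (hr' : r'.Prime) (h1 : p < q) (h2 : q < r)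
    (h1' : p' < q') (h2' : q' < r') (h : p * q * r = p' * q' * r') :
    p = p' ∧ q = q' ∧ r = r' := by
  have aux : ∀ {a x y z : ℕ}, a.Prime → x.Prime → y.Prime → z.Prime → a ∣ x * y * z →
      a = x ∨ a = y ∨ a = z := by
    intro a x y z ha hx hy hz hd
    rcases (Nat.Prime.dvd_mul ha).mp hd with hd | hd
    · rcases (Nat.Prime.dvd_mul ha).mp hd with hd | hd
      · exact Or.inl ((Nat.prime_dvd_prime_iff_eq ha hx).mp hd)
      · exact Or.inr (Or.inl ((Nat.prime_dvd_prime_iff_eq ha hy).mp hd))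
    · exact Or.inr (Or.inr ((Nat.prime_dvd_prime_iff_eq ha hz).mp hd))
  have a1 := aux hp hp' hq' hr' (h ▸ Dvd.intro (q * r) (by ring))
  have a2 := aux hq hp' hq' hr' (h ▸ Dvd.intro (p * r) (by ring))
  have a3 := aux hr hp' hq' hr' (h ▸ Dvd.intro (p * q) (by ring))
  omega

lemma count_lower (x : ℝ) (hx : 0 ≤ x) (Q K : ℕ) (hK : 2 ≤ K) (hQ : Q ^ 10 ≤ ⌊x⌋₊) (H : ℝ)
    (hH : ∀ M ≤ ⌊x⌋₊, ∑ p ∈ prs 0 M, (1 : ℝ) / p ≤ H) :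
    (25 / 27 - 20 / K) * (TT ⌊x⌋₊ Q K).card - 2 * (⌊x⌋₊ * H * √((H + 1) / K)) ≤ NCBcount x := by
  classical
  have hb := bad_total ⌊x⌋₊ Q K (by omega) hQ H hH
  set T := TT ⌊x⌋₊ Q K with hT
  have hmem : ∀ t ∈ T, t.1.Prime ∧ t.2.1.Prime ∧ t.2.2.Prime ∧ 3 ≤ t.1 ∧ t.1 < t.2.1 ∧
      t.2.1 < t.2.2 ∧ t.1 * t.2.1 * t.2.2 ≤ ⌊x⌋₊ := by
    intro t ht
    simp only [hT, TT, Finset.mem_filter, Finset.mem_product, mem_prs] at ht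
    obtain ⟨⟨⟨⟨a, b⟩, c⟩, ⟨d, e⟩, f, g⟩, h, i, j⟩ := ht
    refine ⟨c, e, g, by omega, lt_of_le_of_lt (Nat.le_self_pow (by norm_num) _) h, i, j⟩
  set G := T.filter (fun t => ¬ Bd t.1 t.2.1 t.2.2) with hG
  have hcard : (T.card : ℝ) = ∑ t ∈ T, bd t.1 t.2.1 t.2.2 + G.card := by
    rw [hG, Finset.card_filter]
    push_cast
    rw [← Finset.sum_add_distrib, Finset.card_eq_sum_ones]
    push_cast
    refine Finset.sum_congr rfl fun t _ => ?_
    unfold bd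
    split_ifs <;> norm_num
  have hle : G.card ≤ NCBcount x := by
    rw [← Finset.card_image_of_injOn (f := fun t : ℕ × ℕ × ℕ => t.1 * t.2.1 * t.2.2) (s := G)]
    · unfold NCBcount
      rw [← Set.ncard_coe_finset]
      apply Set.ncard_le_ncard
      · intro n hn
        rw [Finset.mem_coe, Finset.mem_image] at hn
        obtain ⟨⟨p, q, r⟩, ht, rfl⟩ := hn
        rw [hG, Finset.mem_filter] at ht
        obtain ⟨ht, hbad⟩ := ht
        obtain ⟨a, b, c, d, e, f, g⟩ := hmem _ ht
        simp only at a b c d e f g hbad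
        refine ⟨p, q, r, a, b, c, d, e, f, rfl, ?_, ?_⟩
        · exact (Nat.cast_le.mpr g).trans (Nat.floor_le hx)
        · have hz : ∀ s : ℕ, s.Prime → p < s → (s : ZMod p) ≠ 0 := by
            intro s hs hps h0
            rw [ZMod.natCast_eq_zero_iff] at h0
            rw [Nat.prime_dvd_prime_iff_eq a hs] at h0
            omega
          have hgood : Good p ((q : ZMod p)⁻¹.val) ((r : ZMod p)⁻¹.val) := by
            by_contra hng
            exact hbad ⟨hz q b e, hz r c (e.trans f), hng⟩
          have := height_good a b c e.ne (e.trans f).ne f.ne hgood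
          have h3 : (3 : ℝ) * polyHeight (cyclotomic (p * q * r) ℤ) ≤ 2 * p := by exact_mod_cast this
          simp only
          linarith
      · refine (Set.finite_Iic ⌊x⌋₊).subset ?_
        rintro n ⟨p, q, r, _, _, _, _, _, _, _, h, _⟩
        exact Nat.le_floor h
    · intro t ht t' ht' h
      rw [hG, Finset.mem_coe, Finset.mem_filter] at ht ht'
      obtain ⟨a, b, c, d, e, f, g⟩ := hmem _ ht.1
      obtain ⟨a', b', c', d', e', f', g'⟩ := hmem _ ht'.1
      obtain ⟨k1, k2, k3⟩ := triple_inj a b c a' b' c' e f e' f' h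
      ext <;> assumption
  have : (G.card : ℝ) ≤ NCBcount x := by exact_mod_cast hle
  linarith

end CB

namespace CB

lemma M_bound (δ ℓ L : ℝ) (hδ : 0 < δ) (hℓ1 : 1 ≤ ℓ) (hL2 : 2 ≤ L) (hL : log L = ℓ)
    (hbig : 1 + 20 / δ ≤ δ / 2 * ℓ) :
    ∑ p ∈ prs 0 ⌈L ^ 7⌉₊, (1 : ℝ) / p ≤ δ * ℓ := by
  have hL0 : 0 < L := by linarith
  set s := exp (δ / 2 * ℓ) with hs
  have hs1 : 1 < s := by rw [hs]; apply one_lt_exp_iff.mpr; positivity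
  have ht1 : 1 ≤ L ^ 8 := one_le_pow₀ (by linarith)
  have hb := recip_block s (L ^ 8) hs1 ht1
  have hsm := recip_small ⌊s⌋₊
  have hlogs : log s = δ / 2 * ℓ := log_exp _
  have hf : log ⌊s⌋₊ ≤ δ / 2 * ℓ := by
    rw [← hlogs]
    have : 1 ≤ ⌊s⌋₊ := Nat.le_floor (by simpa using hs1.le)
    exact log_le_log (by exact_mod_cast this) (Nat.floor_le (by positivity))
  have hKt : ⌈L ^ 7⌉₊ ≤ ⌊L ^ 8⌋₊ := by
    apply Nat.le_floor
    have h1 := (Nat.ceil_lt_add_one (by positivity : 0 ≤ L ^ 7)).le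
    have h2 : (1 : ℝ) ≤ L ^ 7 := one_le_pow₀ (by linarith)
    have h3 : L ^ 8 = L * L ^ 7 := by ring
    nlinarith
  have hle : ∑ p ∈ prs 0 ⌈L ^ 7⌉₊, (1 : ℝ) / p ≤
      ∑ p ∈ prs 0 ⌊s⌋₊ ∪ prs ⌊s⌋₊ ⌊L ^ 8⌋₊, (1 : ℝ) / p := by
    refine Finset.sum_le_sum_of_subset_of_nonneg ?_ fun _ _ _ => by positivity
    intro p hp
    rw [mem_prs] at hp
    rw [Finset.mem_union, mem_prs, mem_prs]
    rcases le_or_gt p ⌊s⌋₊ with h | h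
    · exact Or.inl ⟨⟨hp.1.1, h⟩, hp.2⟩
    · exact Or.inr ⟨⟨h, hp.1.2.trans hKt⟩, hp.2⟩
  have hdis : Disjoint (prs 0 ⌊s⌋₊) (prs ⌊s⌋₊ ⌊L ^ 8⌋₊) := by
    rw [Finset.disjoint_left]
    intro q h1 h2
    rw [mem_prs] at h1 h2
    omega
  rw [Finset.sum_union hdis] at hle
  have h4 : log 4 ≤ 2 := by
    rw [show (4 : ℝ) = 2 ^ 2 by norm_num, log_pow]
    have := log_two_lt_d9
    push_cast; linarith
  have hb2 : (log (L ^ 8) + log 4) / log s ≤ 20 / δ := by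
    rw [hlogs, log_pow, hL, div_le_div_iff₀ (by positivity) hδ]
    push_cast
    nlinarith
  linarith

lemma D_lower (δ ℓ L x z : ℝ) (hδ : 0 < δ) (hℓ1 : 1 ≤ ℓ) (hL2 : 2 ≤ L) (hL : log L = ℓ)
    (hx : log x = L) (hz : x = z ^ 20) (hz2 : 2 ≤ z) (hzL : L ^ 7 + 1 ≤ z)
    (hbig : 1 + 20 / δ ≤ δ / 2 * ℓ) (hbig2 : 4 ≤ δ * ℓ) :
    (1 - 2 * δ) * ℓ ≤ ∑ p ∈ prs ⌈L ^ 7⌉₊ ⌊z ^ 2⌋₊, (1 : ℝ) / p := by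
  have hM := M_bound δ ℓ L hδ hℓ1 hL2 hL hbig
  have hL0 : 0 < L := by linarith
  have hQz : z ≤ ⌊z ^ 2⌋₊ := by
    have := (Nat.lt_floor_add_one (z ^ 2)).le
    nlinarith
  have hKQ : ⌈L ^ 7⌉₊ ≤ ⌊z ^ 2⌋₊ := by
    have h1 := (Nat.ceil_lt_add_one (by positivity : 0 ≤ L ^ 7)).le
    have : (⌈L ^ 7⌉₊ : ℝ) ≤ ⌊z ^ 2⌋₊ := by linarith
    exact_mod_cast this
  have hsp := recip_split 0 ⌈L ^ 7⌉₊ ⌊z ^ 2⌋₊ (Nat.zero_le _) hKQ (fun p => (1 : ℝ) / p)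
  have hQ2 : 2 ≤ ⌊z ^ 2⌋₊ := by
    have : (2 : ℝ) ≤ ⌊z ^ 2⌋₊ := by linarith
    exact_mod_cast this
  have hlow := recip_lower _ hQ2
  have hlz : log z = L / 20 := by
    rw [hz, log_pow] at hx; push_cast at hx; linarith
  have h1 : L / 20 ≤ log ⌊z ^ 2⌋₊ := by
    rw [← hlz]; exact log_le_log (by linarith) hQz
  have h2 : ℓ - log 20 ≤ log (log ⌊z ^ 2⌋₊) := by
    rw [← hL, ← log_div (by linarith) (by norm_num)]
    exact log_le_log (by positivity) h1
  have h20 : log 20 ≤ 3 := by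
    have : (20 : ℝ) ≤ exp 3 := by
      have := exp_one_gt_d9
      have e : exp 3 = (exp 1) ^ 3 := by rw [← exp_nat_mul]; norm_num
      rw [e]
      calc (20 : ℝ) ≤ 2.718 ^ 3 := by norm_num
        _ ≤ _ := by gcongr; linarith
    rw [← log_exp 3]; exact log_le_log (by norm_num) this
  linarith

set_option maxHeartbeats 1000000 in
lemma final_det (δ ℓ L x z y0 : ℝ) (hδ : 0 < δ) (hδ1 : δ ≤ 1 / 20) (hℓ1 : 1 ≤ ℓ) (hL2 : 2 ≤ L)
    (hL : log L = ℓ) (hx : log x = L) (hz : x = z ^ 20) (hz2 : 2 ≤ z) (hzL : L ^ 7 + 1 ≤ z)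
    (hbig : 1 + 20 / δ ≤ δ / 2 * ℓ) (hbig2 : 25 ≤ δ * ℓ) (hbig3 : 16 ≤ δ * L)
    (hbig4 : 20 ≤ δ * L ^ 7) (hz3 : 2 ≤ δ * z) (hz4 : 2 * y0 ≤ z)
    (hπ : ∀ y ≥ y0, (1 - δ) * y ≤ (Nat.primeCounting ⌊y⌋₊ : ℝ) * log y) :
    (25 / 27 - 10 * δ) * (x * ℓ ^ 2 / (2 * L)) ≤ NCBcount x := by
  have hL0 : 0 < L := by linarith
  have hz0 : 0 < z := by linarith
  have hx0 : 0 < x := by rw [hz]; positivity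
  set Q := ⌊z ^ 2⌋₊ with hQdef
  set K := ⌈L ^ 7⌉₊ with hKdef
  set N := ⌊x⌋₊ with hNdef
  have hQz : (Q : ℝ) ≤ z ^ 2 := Nat.floor_le (by positivity)
  have hQN : Q ^ 10 ≤ N := by
    apply Nat.le_floor
    push_cast
    calc (Q : ℝ) ^ 10 ≤ (z ^ 2) ^ 10 := by gcongr
      _ = x := by rw [hz]; ring
  have hQ1 : z ≤ Q := by
    have := (Nat.lt_floor_add_one (z ^ 2)).le
    nlinarith
  have hKL : L ^ 7 ≤ K := Nat.le_ceil _
  have hL7 : (2 : ℝ) ≤ L ^ 7 := by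
    calc (2 : ℝ) ≤ 2 ^ 7 := by norm_num
      _ ≤ L ^ 7 := by gcongr
  have hK2 : 2 ≤ K := by
    have : (2 : ℝ) ≤ K := by linarith
    exact_mod_cast this
  have hzx : z ≤ x := by rw [hz]; exact le_self_pow₀ (by linarith) (by norm_num)
  have hNx : (N : ℝ) ≤ x := Nat.floor_le hx0.le
  have hNx1 : (1 - δ) * x ≤ N := by
    have := (Nat.lt_floor_add_one x).le
    have h : δ * z ≤ δ * x := by gcongr
    linarith
  have hN2 : 2 ≤ N := Nat.le_floor (by push_cast; linarith)
  have hN0 : (2 : ℝ) ≤ N := by exact_mod_cast hN2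
  have hlN0 : 0 < log N := log_pos (by linarith)
  have hlN : log N ≤ L := by rw [← hx]; exact log_le_log (by linarith) hNx
  -- H
  have hH : ∀ M ≤ N, ∑ p ∈ prs 0 M, (1 : ℝ) / p ≤ 1 + L := by
    intro M hM
    have h1 := recip_small M
    rcases Nat.eq_zero_or_pos M with h | h
    · subst h; simp at h1 ⊢; linarith
    · have : log M ≤ log N := log_le_log (by exact_mod_cast h) (by exact_mod_cast hM)
      linarith
  have hcnt := count_lower x hx0.le Q K hK2 hQN (1 + L) hH
  -- error
  have herr : 2 * ((N : ℝ) * (1 + L) * √((1 + L + 1) / K)) ≤ 8 * x / L ^ 2 := by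
    have h1 : √((1 + L + 1) / K) ≤ 2 / L ^ 3 := by
      apply sqrt_le_iff.mpr
      refine ⟨by positivity, ?_⟩
      calc (1 + L + 1) / (K : ℝ) ≤ (4 * L) / L ^ 7 := by
            gcongr; linarith
        _ = _ := by field_simp; norm_num
    calc _ ≤ 2 * (x * (2 * L) * (2 / L ^ 3)) := by gcongr; linarith
      _ = _ := by field_simp; norm_num
  set Z := x * ℓ ^ 2 / (2 * L) with hZ
  have hZ0 : 0 ≤ Z := by positivity
  have hℓ2 : 1 ≤ ℓ ^ 2 := one_le_pow₀ hℓ1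
  have herr2 : 8 * x / L ^ 2 ≤ δ * Z := by
    rw [hZ, div_le_iff₀ (by positivity)]
    have : δ * (x * ℓ ^ 2 / (2 * L)) * L ^ 2 = x * (δ * L / 2) * ℓ ^ 2 := by field_simp
    rw [this]
    have h2 : x * 8 ≤ x * (δ * L / 2) := by gcongr; linarith
    nlinarith [mul_le_mul h2 hℓ2 (by norm_num) (by positivity)]
  -- W
  set D := ∑ p ∈ prs K Q, (1 : ℝ) / p with hD
  have hDl : (1 - 2 * δ) * ℓ ≤ D :=
    D_lower δ ℓ L x z hδ hℓ1 hL2 hL hx hz hz2 hzL hbig (by linarith)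
  have hW := W_lower K Q hK2 D hD
  have hW2 : (1 - 5 * δ) * ℓ ^ 2 ≤ 2 * WW K Q := by
    have h1 : 25 ≤ δ * ℓ := hbig2
    have h2 : (1 - 3 * δ) * ℓ ≤ D - 25 := by linarith
    have h3 : 0 ≤ (1 - 3 * δ) * ℓ := mul_nonneg (by linarith) (by linarith)
    have h4 : (1 - 2 * δ) * ℓ * ((1 - 3 * δ) * ℓ) ≤ D * (D - 25) :=
      mul_le_mul hDl h2 h3 (by linarith)
    nlinarith [sq_nonneg (δ * ℓ)]
  -- T
  have hyN : y0 ≤ N / (Q : ℝ) ^ 2 := by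
    have hQpos : (0 : ℝ) < Q := by linarith
    rw [le_div_iff₀ (by positivity)]
    have h1 : (Q : ℝ) ^ 2 ≤ z ^ 4 := by
      calc (Q : ℝ) ^ 2 ≤ (z ^ 2) ^ 2 := by gcongr
        _ = _ := by ring
    calc y0 * (Q : ℝ) ^ 2 ≤ (z / 2) * z ^ 4 := by
          have : y0 ≤ z / 2 := by linarith
          exact mul_le_mul this h1 (by positivity) (by positivity)
      _ = z ^ 5 / 2 := by ring
      _ ≤ x / 2 := by
          have : z ^ 5 ≤ x := by rw [hz]; exact pow_le_pow_right₀ (by linarith) (by norm_num)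
          linarith
      _ ≤ (1 - δ) * x := by
          rw [div_eq_inv_mul]
          exact mul_le_mul_of_nonneg_right (by linarith) hx0.le
      _ ≤ N := hNx1
  have hT := TT_lower N Q K hN2 δ y0 (by
    have : (0 : ℝ) < Q := by linarith
    exact_mod_cast this) hyN hπ
  have hQ3 : (Q : ℝ) ^ 3 ≤ δ * Z := by
    have hLz : L ≤ z := by
      have : L ≤ L ^ 7 := le_self_pow₀ (by linarith) (by norm_num)
      linarith
    calc (Q : ℝ) ^ 3 ≤ (z ^ 2) ^ 3 := by gcongr
      _ = z ^ 6 * 1 := by ring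
      _ ≤ z ^ 18 * (δ * z / 2) := by
          have : z ^ 6 ≤ z ^ 18 := pow_le_pow_right₀ (by linarith) (by norm_num)
          apply mul_le_mul this (by linarith) (by norm_num) (by positivity)
      _ = δ * (z ^ 20 * 1 / (2 * z)) := by field_simp
      _ ≤ δ * Z := by
          rw [hZ, hz]; gcongr
  have hNL : (1 - δ) * x / L ≤ N / log N := by
    apply div_le_div₀ (by linarith) hNx1 hlN0 hlN
  have hTT : (1 - 8 * δ) * Z ≤ (TT N Q K).card := by
    have h0 : 0 ≤ (1 - δ) * x / L := div_nonneg (mul_nonneg (by linarith) hx0.le) hL0.le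
    have hW3 : (1 - 5 * δ) * ℓ ^ 2 / 2 ≤ WW K Q := by linarith
    have hW0 : 0 ≤ (1 - 5 * δ) * ℓ ^ 2 / 2 := by
      have : 0 ≤ 1 - 5 * δ := by linarith
      positivity
    have h1 : (1 - δ) * ((1 - δ) * x / L) * ((1 - 5 * δ) * ℓ ^ 2 / 2) ≤
        (1 - δ) * (N / log N) * WW K Q := by
      have hd : 0 ≤ 1 - δ := by linarith
      apply mul_le_mul _ hW3 hW0 (by positivity)
      exact mul_le_mul_of_nonneg_left hNL hd
    have h2 : (1 - δ) * ((1 - δ) * x / L) * ((1 - 5 * δ) * ℓ ^ 2 / 2) =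
        ((1 - δ) * (1 - δ) * (1 - 5 * δ)) * Z := by
      rw [hZ]; field_simp
    have h3 : 1 - 7 * δ ≤ (1 - δ) * (1 - δ) * (1 - 5 * δ) := by nlinarith [sq_nonneg δ]
    have h4 := mul_le_mul_of_nonneg_right h3 hZ0
    linarith
  have hK20 : 20 / (K : ℝ) ≤ δ := by
    have : (0 : ℝ) < K := by linarith
    rw [div_le_iff₀ this]
    have : δ * L ^ 7 ≤ δ * K := by gcongr
    linarith
  have hfin : (25 / 27 - δ) * ((1 - 8 * δ) * Z) ≤ (25 / 27 - 20 / K) * (TT N Q K).card := by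
    apply mul_le_mul (by linarith) hTT
    · exact mul_nonneg (by linarith) hZ0
    · linarith
  have h9 : (25 / 27 - 9 * δ) * Z ≤ (25 / 27 - δ) * ((1 - 8 * δ) * Z) := by
    rw [← mul_assoc]
    apply mul_le_mul_of_nonneg_right _ hZ0
    nlinarith [sq_nonneg δ]
  linarith

lemma final : ∀ ε > (0 : ℝ), ∃ x₀ : ℝ, ∀ x ≥ x₀, (NCBcount x : ℝ) ≥
        (25 / 27 - ε) * (x * (Real.log (Real.log x)) ^ 2) / (2 * Real.log x) := by
  intro ε hε
  set δ := min (ε / 10) (1 / 20) with hδd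
  have hδ : 0 < δ := by rw [hδd]; positivity
  have hδ1 : δ ≤ 1 / 20 := min_le_right _ _
  have hδ2 : δ ≤ ε / 10 := min_le_left _ _
  obtain ⟨y0, hy0⟩ := eventually_atTop.mp (primeCounting_lower hδ (by linarith))
  have tL : Tendsto (fun x : ℝ => log x) atTop atTop := tendsto_log_atTop
  have tl : Tendsto (fun x : ℝ => log (log x)) atTop atTop := tendsto_log_atTop.comp tL
  have tz : Tendsto (fun x : ℝ => x ^ (1 / 20 : ℝ)) atTop atTop := tendsto_rpow_atTop (by norm_num)
  have tLz : ∀ᶠ x : ℝ in atTop, (log x) ^ 7 + 1 ≤ x ^ (1 / 20 : ℝ) := by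
    have h := (isLittleO_log_rpow_rpow_atTop (s := 1 / 20) 7 (by norm_num)).bound
      (by norm_num : (0 : ℝ) < 1 / 2)
    filter_upwards [h, tz.eventually_ge_atTop 2, eventually_ge_atTop 1] with x h1 h2 h3
    rw [norm_of_nonneg (rpow_nonneg (log_nonneg h3) _), norm_of_nonneg (by linarith)] at h1
    have e : log x ^ (7 : ℝ) = log x ^ 7 := by
      rw [show (7 : ℝ) = ((7 : ℕ) : ℝ) by norm_num, rpow_natCast]
    rw [e] at h1
    linarith
  obtain ⟨x₀, hx₀⟩ := eventually_atTop.mp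
    (tLz.and ((tL.eventually_ge_atTop (max 2 (20 / δ))).and
      ((tl.eventually_ge_atTop (max 1 (max (25 / δ) ((1 + 20 / δ) / (δ / 2))))).and
      ((tz.eventually_ge_atTop (max 2 (max (2 / δ) (2 * y0)))).and (eventually_ge_atTop (0 : ℝ))))))
  refine ⟨x₀, fun x hx => ?_⟩
  obtain ⟨h1, h2, h3, h4, h5⟩ := hx₀ x hx
  simp only [max_le_iff] at h2 h3 h4
  have hL7 : log x ≤ log x ^ 7 := le_self_pow₀ (by linarith [h2.1]) (by norm_num)
  have hL20 : 20 ≤ δ * log x := by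
    have := (div_le_iff₀ hδ).mp h2.2; linarith
  have h := final_det δ (log (log x)) (log x) x (x ^ (1 / 20 : ℝ)) y0 hδ hδ1 h3.1 h2.1 rfl rfl
    (by rw [← rpow_natCast, ← rpow_mul h5]; norm_num) h4.1 h1
    (by have := (div_le_iff₀ (by positivity)).mp h3.2.2; linarith)
    (by have := (div_le_iff₀ hδ).mp h3.2.1; linarith)
    (by linarith) (by nlinarith) (by have := (div_le_iff₀ hδ).mp h4.2.1; linarith) h4.2.2 hy0
  refine le_trans ?_ h
  rw [mul_div_assoc]
  apply mul_le_mul_of_nonneg_right (by linarith)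
  have : 0 ≤ log x := by linarith [h2.1]
  positivity

end CB

theorem NCBcount_lower_bound :
    ∀ ε > (0 : ℝ), ∃ x₀ : ℝ, ∀ x ≥ x₀,
      (NCBcount x : ℝ) ≥
        (25 / 27 - ε) * (x * (Real.log (Real.log x)) ^ 2) / (2 * Real.log x) := by
  exact CB.final
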